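/- Hecke-type recursion for the normalized partition function at s_n: Assume σ(n) ∈ [n]. Let s_n ∈ B_n be defined by s_n(n) = n̄ and s_n(j) = j for j < n, and let s_n·x := (x_1,…,x_{n−1},x_n^{−1}). Then F_μ^{σ s_n}(x) = ((1 − ν t q^{−1/2} x_n)(1 + ν^{−1} q^{−1/2} x_n)/(1−x_n²)) · (F_μ^σ(s_n·x) − F_μ^σ(x)) + (t/q)·F_μ^σ(x), provided all denominators appearing are nonzero. Equivalently, F_μ^{σ s_n} = T_n F_μ^σ, where T_n g := −ab·g + ((1−a x_n)(1−b x_n)/(1−x_n²))·(s_n g − g) with a = ν t q^{−1/2} and b = −ν^{−1} q^{−1/2} is the operator of the Noumi representation of the affine Hecke algebra of type C̃_n. -/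

import Mathlib

open scoped BigOperators

/-- The set of colors `{0} ∪ [±n]`, encoded as `Fin (2*n+1)`:
index `i < n` is the positive color `i+1`, index `n` is the color `0`,
and index `k > n` is the negative color `\overline{2*n+1-k}`.
The order on `Fin (2*n+1)` is exactly the color order
`1 < ⋯ < n < 0 < n̄ < ⋯ < 1̄`. -/
abbrev Col (n : ℕ) := Fin (2*n+1)

/-- The color `0` (identified with the `+` spin). -/
def mid (n : ℕ) : Col n := ⟨n, by omega⟩

/-- The bar involution `i ↦ ī` on colors (fixing `0`). -/
def barC (n : ℕ) (c : Col n) : Col n := ⟨2*n - c.val, by omega⟩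

/-- The positive color `i+1` attached to `i : Fin n`. -/
def posC (n : ℕ) (i : Fin n) : Col n := ⟨i.val, by have := i.isLt; omega⟩

/-- Vectors `I ∈ ℕ^{2n}` indexed by the colors `[±n]` (the entry at the
color `0` is irrelevant/always `0`). -/
abbrev Vec (n : ℕ) := Col n → ℕ

/-- `e_j`: the standard basis vector for `j ∈ [±n]`, and `e_0 = 0`. -/
def eV (n : ℕ) (c : Col n) : Vec n := fun k => if c ≠ mid n ∧ k = c then 1 else 0

/-- `I_{[1,n]}`. -/
def sLo (n : ℕ) (I : Vec n) : ℕ := ∑ k ∈ Finset.univ.filter (fun k : Col n => k < mid n), I k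
/-- `I_{[n̄,1̄]}`. -/
def sHi (n : ℕ) (I : Vec n) : ℕ := ∑ k ∈ Finset.univ.filter (fun k : Col n => mid n < k), I k
/-- `I_{≤ l}`. -/
def sLe (n : ℕ) (I : Vec n) (l : Col n) : ℕ := ∑ k ∈ Finset.univ.filter (fun k : Col n => k ≤ l), I k
/-- `I_{< l}`. -/
def sLt (n : ℕ) (I : Vec n) (l : Col n) : ℕ := ∑ k ∈ Finset.univ.filter (fun k : Col n => k < l), I k
/-- `I_{> l}`. -/
def sGt (n : ℕ) (I : Vec n) (l : Col n) : ℕ := ∑ k ∈ Finset.univ.filter (fun k : Col n => l < k), I k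
/-- `I_{≥ l}`. -/
def sGe (n : ℕ) (I : Vec n) (l : Col n) : ℕ := ∑ k ∈ Finset.univ.filter (fun k : Col n => l ≤ k), I k

/-- The Boltzmann weight `L_x(I, j, K, ℓ)` of a Γ vertex (Table 2.1). -/
noncomputable def LW (n : ℕ) (q s x : ℂ) (I : Vec n) (j : Col n) (K : Vec n) (l : Col n) : ℂ :=
  if ∀ k, I k + eV n j k = K k + eV n l k then
    if j = l then
      if l = mid n then (q ^ (-(sLo n I : ℤ)) - s * x * q ^ (sHi n I : ℤ)) / (1 - s * x)
      else if l < mid n then (s * q ^ (I l : ℤ) - x) * q ^ (-(sLe n I l : ℤ)) / (s * (1 - s * x))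
      else s * (s * q ^ (I l : ℤ) - x) * q ^ (sGt n I l : ℤ) / (1 - s * x)
    else if j < l then
      if l = mid n then (x * q ^ (-(sLo n I : ℤ)) - s ^ 2 * x * q ^ (sHi n I : ℤ)) / (s * (1 - s * x))
      else if l < mid n then -x * (1 - q ^ (I l : ℤ)) * q ^ (-(sLe n I l : ℤ)) / (s * (1 - s * x))
      else -(s * x) * (1 - q ^ (I l : ℤ)) * q ^ (sGt n I l : ℤ) / (1 - s * x)
    else
      if l = mid n then (q ^ (-(sLo n I : ℤ)) - s ^ 2 * q ^ (sHi n I : ℤ)) / (1 - s * x)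
      else if l < mid n then -(1 - q ^ (I l : ℤ)) * q ^ (-(sLe n I l : ℤ)) / (1 - s * x)
      else -(s ^ 2) * (1 - q ^ (I l : ℤ)) * q ^ (sGt n I l : ℤ) / (1 - s * x)
  else 0

/-- The Boltzmann weight `M_x(I, j, K, ℓ)` of a Δ vertex (Table 2.2). -/
noncomputable def MW (n : ℕ) (q s x : ℂ) (I : Vec n) (j : Col n) (K : Vec n) (l : Col n) : ℂ :=
  if ∀ k, I k + eV n j k = K k + eV n l k then
    if j = l then
      if l = mid n then (q ^ (-(sHi n I : ℤ)) - s * x * q ^ (sLo n I : ℤ)) / (1 - s * x)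
      else if l < mid n then s * (s * q ^ (I l : ℤ) - x) * q ^ (sLt n I l : ℤ) / (1 - s * x)
      else (1 - s⁻¹ * x * q ^ (-(I l : ℤ))) * q ^ (-(sGt n I l : ℤ)) / (1 - s * x)
    else if j < l then
      if l = mid n then (q ^ (-(sHi n I : ℤ)) - s ^ 2 * q ^ (sLo n I : ℤ)) / (1 - s * x)
      else if l < mid n then -(s ^ 2) * (1 - q ^ (I l : ℤ)) * q ^ (sLt n I l : ℤ) / (1 - s * x)
      else -(1 - q ^ (I l : ℤ)) * q ^ (-(sGe n I l : ℤ)) / (1 - s * x)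
    else
      if l = mid n then x * (s⁻¹ * q ^ (-(sHi n I : ℤ)) - s * q ^ (sLo n I : ℤ)) / (1 - s * x)
      else if l < mid n then -(s * x) * (1 - q ^ (I l : ℤ)) * q ^ (sLt n I l : ℤ) / (1 - s * x)
      else -(s⁻¹ * x) * (1 - q ^ (I l : ℤ)) * q ^ (-(sGe n I l : ℤ)) / (1 - s * x)
  else 0

/-- `φ(z) = (1-z²)/((1-νtz)(1+ν⁻¹z))`. -/
noncomputable def phiF (ν t z : ℂ) : ℂ := (1 - z ^ 2) / ((1 - ν * t * z) * (1 + ν⁻¹ * z))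

/-- The cap vertex Boltzmann weight `Cap_x(ε → ε')` (Figure 2.3), where `ε` is
the incoming bottom color and `ε'` the outgoing top color, and `qh` denotes the
fixed branch of `q^{-1/2}`. -/
noncomputable def capW (n : ℕ) (ν t qh x : ℂ) (ε ε' : Col n) : ℂ :=
  if ε = mid n ∧ ε' = mid n then 1
  else if ε < mid n ∧ ε' = barC n ε then t * phiF ν t (qh * x⁻¹)
  else if ε < mid n ∧ ε' = ε then 1 - t * phiF ν t (qh * x⁻¹)
  else if mid n < ε ∧ ε' = barC n ε then phiF ν t (qh * x⁻¹)
  else if mid n < ε ∧ ε' = ε then 1 - phiF ν t (qh * x⁻¹)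
  else 0

/-- A state of the model on the `2n × L` lattice: the first component assigns a
color to each horizontal edge (row `r : Fin (2n)`, 0-indexed top to bottom, and
horizontal position `p : Fin (L+1)`, with `p = 0` the right boundary and
`p = L` the left boundary; the vertex in the paper's column `c+1` of row `r+1`
lies between positions `c` (east) and `c+1` (west)); the second component
assigns a vector in `ℕ^{2n}` to each vertical edge (level `v : Fin (2n+1)`,
with `v = 0` the top boundary and `v = 2n` the bottom boundary, and column
`c : Fin L`, 0-indexed right to left). -/
abbrev St (n L : ℕ) := (Fin (2*n) × Fin (L+1) → Col n) × (Fin (2*n+1) × Fin L → Vec n)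

/-- The vector assigned at the top of column `c` (the paper's column `c+1`):
`∑_{i=1}^n (1_{μ_i = c+1} e_i + 1_{μ_i = -(c+1)} e_{ī})`. -/
def topV (n L : ℕ) (μ : Fin n → ℤ) (c : Fin L) : Vec n := fun k =>
  ∑ i : Fin n,
    ((if μ i = (c.val : ℤ) + 1 ∧ k = posC n i then 1 else 0) +
     (if μ i = -((c.val : ℤ) + 1) ∧ k = barC n (posC n i) then 1 else 0))

/-- The boundary conditions of the model with data `(σ, μ)`: on the left, the
paper's row `2i-1` (a Δ row, 0-indexed row `2i-2`, even) carries the color `0`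
and the paper's row `2i` (a Γ row, 0-indexed row `2i-1`, odd) carries the color
`σ(i)`; at the bottom every vertical edge carries the zero vector; at the top
the vertical edge in column `c` carries `topV μ c`. -/
def BC (n L : ℕ) (σ : Equiv.Perm (Col n)) (μ : Fin n → ℤ) (st : St n L) : Prop :=
  (∀ r : Fin (2*n), st.1 (r, Fin.last L) =
      if r.val % 2 = 0 then mid n
      else σ (posC n ⟨r.val / 2, by have := r.isLt; omega⟩)) ∧
  (∀ c : Fin L, st.2 (0, c) = topV n L μ c) ∧
  (∀ c : Fin L, st.2 (Fin.last (2*n), c) = fun _ => 0)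

/-- The Boltzmann weight of a state: the product of the weights of all the
Γ, Δ and cap vertices.  Even 0-indexed rows (the paper's odd rows `2i-1`) are
rows of Δ vertices and odd 0-indexed rows (the paper's even rows `2i`) are rows
of Γ vertices, both with spectral parameter `x i`; the cap with spectral
parameter `x i` joins the right end of the paper's row `2i` (incoming, bottom)
to the right end of the paper's row `2i-1` (outgoing, top).
Here `qh` denotes the fixed branch of `q^{-1/2}`. -/
noncomputable def stWt (n L : ℕ) (q s ν t qh : ℂ) (x : Fin n → ℂ) (st : St n L) : ℂ :=
  (∏ r : Fin (2*n), ∏ c : Fin L,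
    if r.val % 2 = 0 then
      MW n q s (x ⟨r.val / 2, by have := r.isLt; omega⟩)
        (st.2 (r.succ, c)) (st.1 (r, c.castSucc)) (st.2 (r.castSucc, c)) (st.1 (r, c.succ))
    else
      LW n q s (x ⟨r.val / 2, by have := r.isLt; omega⟩)
        (st.2 (r.succ, c)) (st.1 (r, c.succ)) (st.2 (r.castSucc, c)) (st.1 (r, c.castSucc)))
  * ∏ i : Fin n,
      capW n ν t qh (x i)
        (st.1 (⟨2 * i.val + 1, by have := i.isLt; omega⟩, 0))
        (st.1 (⟨2 * i.val, by have := i.isLt; omega⟩, 0))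

/-- The partition function `f_μ^σ(x)` of the colored stochastic vertex model
with U-turn boundary: the sum of the Boltzmann weights of all states satisfying
the boundary conditions (the weight of a non-admissible state is `0`, and only
finitely many states have nonzero weight, so this is a finite sum over the
admissible states). -/
noncomputable def pf (n L : ℕ) (q s ν t qh : ℂ) (x : Fin n → ℂ)
    (σ : Equiv.Perm (Col n)) (μ : Fin n → ℤ) : ℂ :=
  ∑ᶠ st ∈ {st : St n L | BC n L σ μ st}, stWt n L q s ν t qh x st

/-- The element `s_i ∈ B_n` (for paper indices `i, i+1`, here 0-indexed `i, i'`
with `i' = i+1`), viewed as the permutation of the colors swapping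
`i ↔ i+1` and `ī ↔ \overline{i+1}`. -/
def siB (n : ℕ) (i i' : Fin n) : Equiv.Perm (Col n) :=
  (Equiv.swap (posC n i) (posC n i')).trans
    (Equiv.swap (barC n (posC n i)) (barC n (posC n i')))

/-- The color `n` (the paper's largest positive color). -/
def lastCol (n : ℕ) : Col n := ⟨n - 1, by omega⟩

/-- The element `s_n ∈ B_n` with `s_n(n) = n̄` and `s_n(j) = j` for `j < n`,
viewed as the permutation of the colors swapping `n ↔ n̄`. -/
def snB (n : ℕ) : Equiv.Perm (Col n) :=
  Equiv.swap (lastCol n) (barC n (lastCol n))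

/-- The Coxeter generating set `{s_1, …, s_{n-1}, s_n}` of `B_n`, viewed as
permutations of the colors. -/
def gensB (n : ℕ) : Set (Equiv.Perm (Col n)) :=
  {g | (∃ i i' : Fin n, (i' : ℕ) = (i : ℕ) + 1 ∧ g = siB n i i') ∨ g = snB n}

/-- The length function `l(σ)` on `B_n` with respect to the Coxeter generators
`s_1, …, s_n`: the minimal length of a word in the generators expressing `σ`. -/
noncomputable def lenB (n : ℕ) (σ : Equiv.Perm (Col n)) : ℕ :=
  sInf {m : ℕ | ∃ w : List (Equiv.Perm (Col n)),
    w.length = m ∧ (∀ g ∈ w, g ∈ gensB n) ∧ w.prod = σ}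

/-- The normalized partition function `F_μ^σ(x)`, where `r j` is the fixed
choice of the square root `√((x_j² - q)/(1 - q x_j²))` and `qh` is the fixed
branch of `q^{-1/2}`. -/
noncomputable def Fnorm (n L : ℕ) (q s ν t qh : ℂ) (x r : Fin n → ℂ)
    (σ : Equiv.Perm (Col n)) (μ : Fin n → ℤ) : ℂ :=
  q ^ (lenB n σ + ∑ j : Fin n, (n - 1 - j.val) * (if σ (posC n j) < mid n then 1 else 0))
    * s ^ (-(2 * (L : ℤ) * (∑ j : Fin n, if mid n < σ (posC n j) then (1 : ℤ) else 0)))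
    * (t / q) ^ (∑ j : Fin n, if mid n < σ (posC n j) then 1 else 0)
    * (∏ j : Fin n, ((1 - s * x j) / (s - x j)) ^ L)
    * (∏ j : Fin n, r j)
    * pf n L q s ν t qh x σ μ

/-! ### Two-row local model -/

lemma eV_mid (n : ℕ) (k : Col n) : eV n (mid n) k = 0 := by simp [eV]

lemma eV_self (n : ℕ) {a : Col n} (ha : a ≠ mid n) : eV n a a = 1 := by simp [eV, ha]

lemma eV_ne (n : ℕ) {a k : Col n} (h : k ≠ a) : eV n a k = 0 := by simp [eV, h]

lemma eV_eq_zero_iff (n : ℕ) (a : Col n) : (∀ k, eV n a k = 0) ↔ a = mid n := by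
  constructor
  · intro h
    by_contra ha
    have := h a
    rw [eV_self n ha] at this
    omega
  · rintro rfl k
    exact eV_mid n k

/-- Straight Γ weight with empty bottom. -/
noncomputable def gP (n : ℕ) (s x : ℂ) (a : Col n) : ℂ :=
  if a < mid n then (s - x) / (s * (1 - s * x)) else s * (s - x) / (1 - s * x)

/-- Turning Γ weight with empty bottom. -/
noncomputable def gU (n : ℕ) (s x : ℂ) (a : Col n) : ℂ :=
  if a < mid n then x * (1 - s ^ 2) / (s * (1 - s * x)) else (1 - s ^ 2) / (1 - s * x)

/-- Straight Δ weight with empty bottom. -/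
noncomputable def dP (n : ℕ) (s x : ℂ) (a : Col n) : ℂ :=
  if a < mid n then s * (s - x) / (1 - s * x) else (s - x) / (s * (1 - s * x))

/-- Turning Δ weight with empty bottom. -/
noncomputable def dU (n : ℕ) (s x : ℂ) (a : Col n) : ℂ :=
  if a < mid n then (1 - s ^ 2) / (1 - s * x) else x * (1 - s ^ 2) / (s * (1 - s * x))

/-- Vertical Δ weight with one particle at the bottom. -/
noncomputable def dT (n : ℕ) (q s x : ℂ) (a : Col n) : ℂ :=
  if a < mid n then (1 - s * x * q) / (1 - s * x) else (q⁻¹ - s * x) / (1 - s * x)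

/-- Δ weight with one particle at the bottom leaving to the left. -/
noncomputable def dX (n : ℕ) (q s x : ℂ) (a : Col n) : ℂ :=
  if a < mid n then -(s * x) * (1 - q) / (1 - s * x) else -(1 - q) * q⁻¹ / (1 - s * x)

section weights
variable (n : ℕ) (q s x : ℂ)

lemma LW_cons {I K : Vec n} {j l : Col n} (h : LW n q s x I j K l ≠ 0) :
    ∀ k, I k + eV n j k = K k + eV n l k := by
  by_contra hc
  exact h (by rw [LW, if_neg hc])

lemma MW_cons {I K : Vec n} {j l : Col n} (h : MW n q s x I j K l ≠ 0) :
    ∀ k, I k + eV n j k = K k + eV n l k := by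
  by_contra hc
  exact h (by rw [MW, if_neg hc])

lemma LW_mid (hD : 1 - s * x ≠ 0) : LW n q s x (fun _ => 0) (mid n) (fun _ => 0) (mid n) = 1 := by
  simp [LW, sLo, sHi, hD]

lemma MW_mid (hD : 1 - s * x ≠ 0) : MW n q s x (fun _ => 0) (mid n) (fun _ => 0) (mid n) = 1 := by
  simp [MW, sLo, sHi, hD]

lemma LW_pass {a : Col n} (ha : a ≠ mid n) :
    LW n q s x (fun _ => 0) a (fun _ => 0) a = gP n s x a := by
  simp [LW, gP, sLe, sGt, ha]

lemma MW_pass {a : Col n} (hs : s ≠ 0) (ha : a ≠ mid n) :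
    MW n q s x (fun _ => 0) a (fun _ => 0) a = dP n s x a := by
  simp only [MW, dP, sLt, sGt, ha]
  simp
  congr 1
  by_cases hD : 1 - s * x = 0
  · simp [hD]
  · field_simp

lemma LW_turn {a : Col n} (ha : a ≠ mid n) :
    LW n q s x (fun _ => 0) a (eV n a) (mid n) = gU n s x a := by
  rcases lt_or_gt_of_ne ha with h | h
  · simp [LW, gU, sLo, sHi, ha, h, eV_mid]; ring
  · simp [LW, gU, sLo, sHi, ha, not_lt_of_gt h, eV_mid]

lemma MW_turn {a : Col n} (hs : s ≠ 0) (ha : a ≠ mid n) :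
    MW n q s x (fun _ => 0) a (eV n a) (mid n) = dU n s x a := by
  rcases lt_or_gt_of_ne ha with h | h
  · simp [MW, dU, sLo, sHi, ha, h, eV_mid]
  · simp [MW, dU, sLo, sHi, ha, not_lt_of_gt h, eV_mid]
    by_cases hD : 1 - s * x = 0
    · simp [hD]
    · field_simp

lemma sum_eV (p : Col n → Prop) [DecidablePred p] {a : Col n} (ha : a ≠ mid n) :
    ∑ k ∈ Finset.univ.filter p, eV n a k = if p a then 1 else 0 := by
  simp [eV, ha]

lemma MW_vert {a : Col n} (ha : a ≠ mid n) :
    MW n q s x (eV n a) (mid n) (eV n a) (mid n) = dT n q s x a := by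
  rcases lt_or_gt_of_ne ha with h | h
  · simp [MW, dT, sLo, sHi, sum_eV n _ ha, h, not_lt_of_gt h]
  · simp [MW, dT, sLo, sHi, sum_eV n _ ha, h, not_lt_of_gt h]

lemma MW_exit {a : Col n} (ha : a ≠ mid n) :
    MW n q s x (eV n a) (mid n) (fun _ => 0) a = dX n q s x a := by
  rcases lt_or_gt_of_ne ha with h | h
  · simp [MW, dX, sLt, sum_eV n _ ha, h, not_lt_of_gt h, eV_mid, ha.symm, eV_self n ha, ha]
  · simp [MW, dX, sGe, sum_eV n _ ha, h, not_lt_of_gt h, eV_mid, ha.symm, eV_self n ha, ha]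

/-- Combined weight of the two vertices in one column, bottom empty. Pairs are (Γ, Δ) colors. -/
noncomputable def wt2 (K : Vec n) (p p' : Col n × Col n) : ℂ :=
  LW n q s x (fun _ => 0) p.1 (fun k => eV n p.1 k - eV n p'.1 k) p'.1 *
    MW n q s x (fun k => eV n p.1 k - eV n p'.1 k) p'.2 K p.2

/-- Two-row partition function with empty bottom and cap on the right. -/
noncomputable def YY (cp : Col n → Col n → ℂ) : (L : ℕ) → (Fin L → Vec n) → Col n × Col n → ℂ
  | 0, _, p => cp p.1 p.2
  | L + 1, K, p => ∑ p' : Col n × Col n,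
      wt2 n q s x (K (Fin.last L)) p p' * YY cp L (fun c => K c.castSucc) p'

variable (cp : Col n → Col n → ℂ)

lemma wt2_mid (hD : 1 - s * x ≠ 0) (K : Vec n) (b : Col n) (p' : Col n × Col n) :
    wt2 n q s x K (mid n, b) p' =
      if p'.1 = mid n then MW n q s x (fun _ => 0) p'.2 K b else 0 := by
  split_ifs with h
  · simp [wt2, h, eV_mid, LW_mid n q s x hD]
  · rw [wt2, mul_eq_zero]; left
    by_contra hc
    have := LW_cons n q s x hc p'.1
    simp [eV_mid, eV_self n h] at this

lemma MW_zero_mid (hD : 1 - s * x ≠ 0) (K : Vec n) (b : Col n) :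
    MW n q s x (fun _ => 0) (mid n) K b = if b = mid n ∧ (∀ k, K k = 0) then 1 else 0 := by
  split_ifs with h
  · obtain ⟨rfl, h⟩ := h
    have : K = fun _ => 0 := funext h
    subst this
    exact MW_mid n q s x hD
  · by_contra hc
    have := MW_cons n q s x hc
    apply h
    simp only [eV_mid] at this
    refine ⟨(eV_eq_zero_iff n b).1 fun k => ?_, fun k => ?_⟩ <;> have := this k <;> omega

lemma YY_mid (hcp : ∀ b, cp (mid n) b = if b = mid n then 1 else 0) (hD : 1 - s * x ≠ 0)
    (L : ℕ) (K : Fin L → Vec n) (b : Col n) :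
    YY n q s x cp L K (mid n, b) = if b = mid n ∧ (∀ c k, K c k = 0) then 1 else 0 := by
  induction L generalizing b with
  | zero => simp [YY, hcp]
  | succ L ih =>
    rw [YY, Fintype.sum_prod_type, Finset.sum_eq_single (mid n), Finset.sum_eq_single (mid n)]
    · have hF := Fin.forall_fin_succ' (P := fun c => ∀ k, K c k = 0)
      rw [wt2_mid n q s x hD, ih, if_pos rfl, MW_zero_mid n q s x hD]
      by_cases h1 : b = mid n <;> by_cases h2 : ∀ k, K (Fin.last L) k = 0 <;> simp [h1, h2, hF]
    · intro b' _ hb'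
      rw [ih, if_neg (by simp [hb']), mul_zero]
    · simp
    · intro a' _ ha'
      apply Finset.sum_eq_zero
      intro b' _
      rw [wt2_mid n q s x hD, if_neg ha', zero_mul]
    · simp

lemma YY_succ (hcp : ∀ b, cp (mid n) b = if b = mid n then 1 else 0) (hD : 1 - s * x ≠ 0)
    (L : ℕ) (K : Fin (L+1) → Vec n) {a : Col n} (ha : a ≠ mid n) (b : Col n) :
    YY n q s x cp (L+1) K (a, b) =
      gP n s x a * (∑ b', MW n q s x (fun _ => 0) b' (K (Fin.last L)) b *
        YY n q s x cp L (fun c => K c.castSucc) (a, b'))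
      + (if ∀ c k, K (Fin.castSucc c) k = 0 then
          gU n s x a * MW n q s x (eV n a) (mid n) (K (Fin.last L)) b else 0) := by
  rw [YY, Fintype.sum_prod_type, Finset.sum_eq_add a (mid n) ha]
  · congr 1
    · rw [Finset.mul_sum]
      apply Finset.sum_congr rfl
      intro b' _
      simp only [wt2, Nat.sub_self]
      rw [LW_pass n q s x ha]; ring
    · rw [Finset.sum_eq_single (mid n)]
      · rw [YY_mid n q s x cp hcp hD]
        simp only [wt2, eV_mid, Nat.sub_zero]
        rw [show (fun k => eV n a k) = eV n a from rfl, LW_turn n q s x ha]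
        simp
      · intro b' _ hb'
        rw [YY_mid n q s x cp hcp hD, if_neg (by simp [hb']), mul_zero]
      · simp
  · intro a' _ ha'
    apply Finset.sum_eq_zero
    intro b' _
    convert zero_mul _
    rw [wt2, mul_eq_zero]; left
    by_contra hc
    have := LW_cons n q s x hc a'
    simp [eV_ne n ha'.1, eV_self n ha'.2] at this
  · simp
  · simp

/-- The closed two-row amplitudes with nonzero left outgoing color. -/
noncomputable def GG (a b : Col n) : ℕ → ℂ
  | 0 => cp a b
  | L + 1 => gP n s x a * dP n s x b * GG a b L + if b = a then gU n s x a * dX n q s x a else 0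

lemma MW_zero_out (hs : s ≠ 0) {b b' : Col n} (hb : b ≠ mid n) (K : Vec n) :
    MW n q s x (fun _ => 0) b' K b = if b' = b ∧ (∀ k, K k = 0) then dP n s x b else 0 := by
  split_ifs with h
  · obtain ⟨rfl, h⟩ := h
    have : K = fun _ => 0 := funext h
    subst this
    exact MW_pass n q s x hs hb
  · by_contra hc
    have := MW_cons n q s x hc
    have hbb : b' = b := by
      by_contra hne
      have := this b
      rw [eV_self n hb, eV_ne n (Ne.symm hne)] at this
      omega
    subst hbb
    exact h ⟨rfl, fun k => by have := this k; omega⟩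

lemma MW_e_out {a b : Col n} (ha : a ≠ mid n) (hb : b ≠ mid n) (K : Vec n) :
    MW n q s x (eV n a) (mid n) K b = if b = a ∧ (∀ k, K k = 0) then dX n q s x a else 0 := by
  split_ifs with h
  · obtain ⟨rfl, h⟩ := h
    have : K = fun _ => 0 := funext h
    subst this
    exact MW_exit n q s x hb
  · by_contra hc
    have := MW_cons n q s x hc
    have hbb : b = a := by
      by_contra hne
      have := this b
      rw [eV_self n hb, eV_ne n hne, eV_mid] at this
      omega
    subst hbb
    exact h ⟨rfl, fun k => by have := this k; rw [eV_mid] at this; omega⟩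

lemma YY_out (hcp : ∀ b, cp (mid n) b = if b = mid n then 1 else 0) (hs : s ≠ 0)
    (hD : 1 - s * x ≠ 0)
    (L : ℕ) (K : Fin L → Vec n) {a b : Col n} (ha : a ≠ mid n) (hb : b ≠ mid n) :
    YY n q s x cp L K (a, b) = if ∀ c k, K c k = 0 then GG n q s x cp a b L else 0 := by
  induction L with
  | zero => simp [YY, GG]
  | succ L ih =>
    rw [YY_succ n q s x cp hcp hD L K ha, Finset.sum_eq_single b, ih, MW_zero_out n q s x hs hb,
      MW_e_out n q s x ha hb, GG]
    · have hF := Fin.forall_fin_succ' (P := fun c => ∀ k, K c k = 0)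
      by_cases h1 : b = a <;> by_cases h2 : ∀ k, K (Fin.last L) k = 0 <;>
        by_cases h3 : ∀ c k, K (Fin.castSucc c) k = 0 <;> simp [h1, h2, h3, hF] <;> ring
    · intro b' _ hb'
      rw [MW_zero_out n q s x hs hb, if_neg (by simp [hb']), zero_mul]
    · simp

lemma MW_zero_in (hs : s ≠ 0) {b' : Col n} (hb : b' ≠ mid n) (K : Vec n) :
    MW n q s x (fun _ => 0) b' K (mid n) = if K = eV n b' then dU n s x b' else 0 := by
  split_ifs with h
  · subst h
    exact MW_turn n q s x hs hb
  · by_contra hc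
    have := MW_cons n q s x hc
    exact h (funext fun k => by have := this k; rw [eV_mid] at this; omega)

lemma MW_e_mid {a : Col n} (ha : a ≠ mid n) (K : Vec n) :
    MW n q s x (eV n a) (mid n) K (mid n) = if K = eV n a then dT n q s x a else 0 := by
  split_ifs with h
  · subst h
    exact MW_vert n q s x ha
  · by_contra hc
    have := MW_cons n q s x hc
    exact h (funext fun k => by have := this k; rw [eV_mid] at this; omega)

lemma YY_succ_zero (hcp : ∀ b, cp (mid n) b = if b = mid n then 1 else 0) (hs : s ≠ 0)
    (hD : 1 - s * x ≠ 0)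
    (L : ℕ) (K : Fin (L+1) → Vec n) {a : Col n} (ha : a ≠ mid n)
    (hK : K (Fin.last L) = fun _ => 0) :
    YY n q s x cp (L+1) K (a, mid n) =
      gP n s x a * YY n q s x cp L (fun c => K c.castSucc) (a, mid n) := by
  have h0 : ∀ b : Col n, b ≠ mid n → (fun _ => 0) ≠ eV n b := by
    intro b hb h
    have := congrFun h b
    rw [eV_self n hb] at this
    omega
  rw [YY_succ n q s x cp hcp hD L K ha, Finset.sum_eq_single (mid n), hK, MW_mid n q s x hD,
    MW_e_mid n q s x ha, if_neg (h0 a ha)]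
  · simp
  · intro b' _ hb'
    rw [hK, MW_zero_in n q s x hs hb', if_neg (h0 b' hb'), zero_mul]
  · simp

lemma GG_zero {a b : Col n} (hab : b ≠ a) (h : cp a b = 0) (L : ℕ) : GG n q s x cp a b L = 0 := by
  induction L with
  | zero => exact h
  | succ L ih => simp [GG, ih, hab]

lemma YY_succ_ne (hcp : ∀ b, cp (mid n) b = if b = mid n then 1 else 0) (hs : s ≠ 0)
    (hD : 1 - s * x ≠ 0)
    (L : ℕ) (K : Fin (L+1) → Vec n) {a d : Col n} (ha : a ≠ mid n) (hd : d ≠ mid n) (had : a ≠ d)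
    (hcd : ∀ b, b ≠ a → b ≠ d → cp a b = 0)
    (hK : K (Fin.last L) ≠ fun _ => 0) :
    YY n q s x cp (L+1) K (a, mid n) =
      if ∀ c k, K (Fin.castSucc c) k = 0 then
      gP n s x a * ((if K (Fin.last L) = eV n a then dU n s x a * GG n q s x cp a a L else 0)
        + (if K (Fin.last L) = eV n d then dU n s x d * GG n q s x cp a d L else 0))
      + (if K (Fin.last L) = eV n a then gU n s x a * dT n q s x a else 0) else 0 := by
  rw [YY_succ n q s x cp hcp hD L K ha, Finset.sum_eq_add a d had]
  · rw [YY_out n q s x cp hcp hs hD L _ ha ha, YY_out n q s x cp hcp hs hD L _ ha hd,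
      MW_zero_in n q s x hs ha, MW_zero_in n q s x hs hd, MW_e_mid n q s x ha]
    by_cases h3 : ∀ c k, K (Fin.castSucc c) k = 0 <;> simp [h3]
  · intro b' _ hb'
    by_cases hm : b' = mid n
    · subst hm
      rw [MW_zero_mid n q s x hD, if_neg, zero_mul]
      rintro ⟨_, h⟩
      exact hK (funext h)
    · rw [YY_out n q s x cp hcp hs hD L _ ha hm, GG_zero n q s x cp hb'.1 (hcd _ hb'.1 hb'.2)]
      simp
  · simp
  · simp

end weights

/-! ### Caps and closed forms -/

section closed
variable (n : ℕ) (ν t qh q s x : ℂ)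

lemma barC_gt {c : Col n} (hc : c < mid n) : mid n < barC n c := by
  simp only [Fin.lt_def, barC, mid] at *; omega

lemma barC_barC (c : Col n) : barC n (barC n c) = c := by
  ext; simp only [barC]; omega

lemma capW_mid (b : Col n) : capW n ν t qh x (mid n) b = if b = mid n then 1 else 0 := by
  simp [capW]

lemma capW_cc {c : Col n} (hc : c < mid n) :
    capW n ν t qh x c c = 1 - t * phiF ν t (qh * x⁻¹) := by
  have h1 := barC_gt n hc
  simp [capW, hc, hc.ne, (hc.trans h1).ne]

lemma capW_cd {c : Col n} (hc : c < mid n) :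
    capW n ν t qh x c (barC n c) = t * phiF ν t (qh * x⁻¹) := by
  simp [capW, hc, hc.ne]

lemma capW_dd {c : Col n} (hc : c < mid n) :
    capW n ν t qh x (barC n c) (barC n c) = 1 - phiF ν t (qh * x⁻¹) := by
  have h1 := barC_gt n hc
  simp [capW, h1, h1.ne', barC_barC, not_lt_of_gt h1, (hc.trans h1).ne']

lemma capW_dc {c : Col n} (hc : c < mid n) :
    capW n ν t qh x (barC n c) c = phiF ν t (qh * x⁻¹) := by
  have h1 := barC_gt n hc
  simp [capW, h1, h1.ne', barC_barC, not_lt_of_gt h1]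

lemma capW_other {a : Col n} (ha : a ≠ mid n) (b : Col n) (h1 : b ≠ a) (h2 : b ≠ barC n a) :
    capW n ν t qh x a b = 0 := by
  simp [capW, ha, h1, h2]

variable (cp : Col n → Col n → ℂ)

lemma GG_cc {c : Col n} (hc : c < mid n) (hs : s ≠ 0) (hD : 1 - s * x ≠ 0) (hx : 1 - x ^ 2 ≠ 0)
    (L : ℕ) :
    GG n q s x cp c c L = -(x ^ 2 * (1 - q)) / (1 - x ^ 2) +
      (((s - x) / (1 - s * x)) ^ L) ^ 2 * (cp c c + x ^ 2 * (1 - q) / (1 - x ^ 2)) := by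
  induction L with
  | zero => simp only [GG]; ring
  | succ L ih =>
    simp only [GG, ih, gP, dP, gU, dX, hc, if_true, pow_succ _ L]
    generalize ((s - x) / (1 - s * x)) ^ L = U
    field_simp
    ring

lemma GG_dd {d : Col n} (hd : mid n < d) (hs : s ≠ 0) (hq : q ≠ 0) (hD : 1 - s * x ≠ 0)
    (hx : 1 - x ^ 2 ≠ 0) (L : ℕ) :
    GG n q s x cp d d L = -(1 - q) / (q * (1 - x ^ 2)) +
      (((s - x) / (1 - s * x)) ^ L) ^ 2 * (cp d d + (1 - q) / (q * (1 - x ^ 2))) := by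
  induction L with
  | zero => simp only [GG]; ring
  | succ L ih =>
    simp only [GG, ih, gP, dP, gU, dX, not_lt_of_gt hd, if_true, if_false, pow_succ _ L]
    generalize ((s - x) / (1 - s * x)) ^ L = U
    field_simp
    ring

lemma GG_cd {c d : Col n} (hc : c < mid n) (hd : mid n < d) (L : ℕ) :
    GG n q s x cp c d L = (((s - x) / (1 - s * x)) ^ L) ^ 2 * ((s ^ L) ^ 2)⁻¹ * cp c d := by
  induction L with
  | zero => simp [GG]
  | succ L ih =>
    simp only [GG, ih, gP, dP, hc, not_lt_of_gt hd, if_true, if_false, (hc.trans hd).ne', pow_succ _ L]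
    generalize ((s - x) / (1 - s * x)) ^ L = U
    generalize s ^ L = S
    simp only [div_eq_mul_inv, mul_inv]
    ring

lemma GG_dc {c d : Col n} (hc : c < mid n) (hd : mid n < d) (L : ℕ) :
    GG n q s x cp d c L = (((s - x) / (1 - s * x)) ^ L) ^ 2 * ((s ^ L) ^ 2) * cp d c := by
  induction L with
  | zero => simp [GG]
  | succ L ih =>
    simp only [GG, ih, gP, dP, hc, not_lt_of_gt hd, if_true, if_false, (hc.trans hd).ne, pow_succ _ L]
    generalize ((s - x) / (1 - s * x)) ^ L = U
    generalize s ^ L = S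
    simp only [div_eq_mul_inv]
    ring
end closed

/-! ### The two algebraic identities -/

lemma alg_c (a b q s x U S : ℂ) (hq : q ≠ 0) (hs : s ≠ 0) (_hx : x ≠ 0) (hD : 1 - s * x ≠ 0)
    (hD' : x - s ≠ 0) (h1 : 1 - x ^ 2 ≠ 0) (h2 : x ^ 2 - q ≠ 0)
    (ha : x - a ≠ 0) (hb : x - b ≠ 0) (ha' : 1 - a * x ≠ 0) (hb' : 1 - b * x ≠ 0)
    (hU : U ≠ 0) (hS : S ≠ 0) :
    (-(a * b * q)) * ((S * s) ^ 2)⁻¹ * (U * ((s - x) / (1 - s * x)))⁻¹ *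
      (s * (s - x) / (1 - s * x) * ((1 - s ^ 2) / (1 - s * x) *
        (U ^ 2 * S ^ 2 * ((q * x ^ 2 - 1) / (q * (x - a) * (x - b))))))
    = (1 - a * x) * (1 - b * x) / (1 - x ^ 2) *
      ((U * ((s - x) / (1 - s * x))) * ((1 - q * x ^ 2) / (x ^ 2 - q)) *
        ((s * x - 1) / (s * (x - s)) * ((1 - s ^ 2) * x / (x - s) *
          ((1 - q) / (1 - x ^ 2) + U⁻¹ ^ 2 *
            (1 + a * b * q * ((q - x ^ 2) / (q * (1 - a * x) * (1 - b * x)))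
              - (1 - q) / (1 - x ^ 2)))) +
          (1 - s ^ 2) / (s * (x - s)) * ((x - s * q) / (x - s)))
      - (U * ((s - x) / (1 - s * x)))⁻¹ *
        ((s - x) / (s * (1 - s * x)) * ((1 - s ^ 2) / (1 - s * x) *
          (-(x ^ 2 * (1 - q)) / (1 - x ^ 2) + U ^ 2 *
            (1 + a * b * q * ((q * x ^ 2 - 1) / (q * (x - a) * (x - b)))
              + x ^ 2 * (1 - q) / (1 - x ^ 2)))) +
          x * (1 - s ^ 2) / (s * (1 - s * x)) * ((1 - s * x * q) / (1 - s * x))))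
      + (-(a * b)) * ((U * ((s - x) / (1 - s * x)))⁻¹ *
        ((s - x) / (s * (1 - s * x)) * ((1 - s ^ 2) / (1 - s * x) *
          (-(x ^ 2 * (1 - q)) / (1 - x ^ 2) + U ^ 2 *
            (1 + a * b * q * ((q * x ^ 2 - 1) / (q * (x - a) * (x - b)))
              + x ^ 2 * (1 - q) / (1 - x ^ 2)))) +
          x * (1 - s ^ 2) / (s * (1 - s * x)) * ((1 - s * x * q) / (1 - s * x)))) := by
  have hD'' : s - x ≠ 0 := by intro h; apply hD'; linear_combination -h
  have e1 : s - x = -(x - s) := by ring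
  have e2 : s * x - 1 = -(1 - s * x) := by ring
  have e3 : q - x ^ 2 = -(x ^ 2 - q) := by ring
  rw [e1, e2, e3]
  field_simp
  ring

lemma alg_d (a b q s x U S : ℂ) (hq : q ≠ 0) (hs : s ≠ 0) (_hx : x ≠ 0) (hD : 1 - s * x ≠ 0)
    (hD' : x - s ≠ 0) (h1 : 1 - x ^ 2 ≠ 0) (h2 : x ^ 2 - q ≠ 0)
    (ha : x - a ≠ 0) (hb : x - b ≠ 0) (ha' : 1 - a * x ≠ 0) (hb' : 1 - b * x ≠ 0)
    (hU : U ≠ 0) (hS : S ≠ 0) :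
    (-(a * b * q)) * ((S * s) ^ 2)⁻¹ * (U * ((s - x) / (1 - s * x)))⁻¹ *
      (s * (s - x) / (1 - s * x) * (x * (1 - s ^ 2) / (s * (1 - s * x)) *
        (-(1 - q) / (q * (1 - x ^ 2)) + U ^ 2 *
          (1 - (q * x ^ 2 - 1) / (q * (x - a) * (x - b)) + (1 - q) / (q * (1 - x ^ 2))))) +
        (1 - s ^ 2) / (1 - s * x) * ((q⁻¹ - s * x) / (1 - s * x)))
    = (1 - a * x) * (1 - b * x) / (1 - x ^ 2) *
      ((U * ((s - x) / (1 - s * x))) * ((1 - q * x ^ 2) / (x ^ 2 - q)) *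
        ((s * x - 1) / (s * (x - s)) * ((1 - s ^ 2) / (s * (x - s)) *
          (U⁻¹ ^ 2 * (S ^ 2)⁻¹ *
            (-(a * b * q) * ((q - x ^ 2) / (q * (1 - a * x) * (1 - b * x)))))))
      - (U * ((s - x) / (1 - s * x)))⁻¹ *
        ((s - x) / (s * (1 - s * x)) * (x * (1 - s ^ 2) / (s * (1 - s * x)) *
          (U ^ 2 * (S ^ 2)⁻¹ *
            (-(a * b * q) * ((q * x ^ 2 - 1) / (q * (x - a) * (x - b))))))))
      + (-(a * b)) * ((U * ((s - x) / (1 - s * x)))⁻¹ *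
        ((s - x) / (s * (1 - s * x)) * (x * (1 - s ^ 2) / (s * (1 - s * x)) *
          (U ^ 2 * (S ^ 2)⁻¹ *
            (-(a * b * q) * ((q * x ^ 2 - 1) / (q * (x - a) * (x - b)))))))) := by
  have hD'' : s - x ≠ 0 := by intro h; apply hD'; linear_combination -h
  have e1 : s - x = -(x - s) := by ring
  have e2 : s * x - 1 = -(1 - s * x) := by ring
  have e3 : q - x ^ 2 = -(x ^ 2 - q) := by ring
  rw [e1, e2, e3]
  field_simp
  ring

/-- The local (two-row) form of the recursion. -/
theorem local_rec (n : ℕ) (q s ν t qh x : ℂ)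
    (hq : q ≠ 0) (hs : s ≠ 0) (hν : ν ≠ 0) (hqh : qh ^ 2 * q = 1)
    (hx0 : x ≠ 0) (hsx : 1 - s * x ≠ 0) (hxs : s - x ≠ 0)
    (hc1 : 1 - ν * t * (qh * x⁻¹) ≠ 0) (hc2 : 1 + ν⁻¹ * (qh * x⁻¹) ≠ 0)
    (hden2 : x ^ 2 - q ≠ 0) (hden3 : 1 - x ^ 2 ≠ 0) (hden4 : 1 - s * x⁻¹ ≠ 0)
    (hden5 : 1 - ν * t * (qh * x) ≠ 0) (hden6 : 1 + ν⁻¹ * (qh * x) ≠ 0)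
    {c : Col n} (hc : c < mid n) (L : ℕ) (K : Fin L → Vec n) :
    t * ((s ^ L) ^ 2)⁻¹ * (((s - x) / (1 - s * x)) ^ L)⁻¹ *
        YY n q s x (capW n ν t qh x) L K (barC n c, mid n)
      = (1 - ν * t * qh * x) * (1 + ν⁻¹ * qh * x) / (1 - x ^ 2) *
        (((s - x) / (1 - s * x)) ^ L * ((1 - q * x ^ 2) / (x ^ 2 - q)) *
            YY n q s x⁻¹ (capW n ν t qh x⁻¹) L K (c, mid n)
          - (((s - x) / (1 - s * x)) ^ L)⁻¹ * YY n q s x (capW n ν t qh x) L K (c, mid n))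
        + t / q * ((((s - x) / (1 - s * x)) ^ L)⁻¹ *
          YY n q s x (capW n ν t qh x) L K (c, mid n)) := by
  have hd := barC_gt n hc
  have hcd := (hc.trans hd).ne
  have hxs' : x - s ≠ 0 := by intro h; apply hxs; linear_combination -h
  obtain ⟨a, haa⟩ : ∃ a, a = ν * t * qh := ⟨_, rfl⟩
  obtain ⟨b, hbb⟩ : ∃ b, b = -(ν⁻¹ * qh) := ⟨_, rfl⟩
  have hνν : ν * ν⁻¹ = 1 := mul_inv_cancel₀ hν
  have hxx : x * x⁻¹ = 1 := mul_inv_cancel₀ hx0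
  have hab : a * b * q = -t := by
    rw [haa, hbb]; linear_combination (-t * qh ^ 2 * q) * hνν - t * hqh
  have hab' : t / q = -(a * b) := by
    rw [div_eq_iff hq]; linear_combination hab
  have ht : t = -(a * b * q) := by rw [hab]; ring
  have h1 : x - a ≠ 0 := by
    intro h; apply hc1
    have : x⁻¹ * (x - a) = 0 := by rw [h, mul_zero]
    rw [haa] at this
    linear_combination this - hxx
  have h2 : x - b ≠ 0 := by
    intro h; apply hc2
    have : x⁻¹ * (x - b) = 0 := by rw [h, mul_zero]
    rw [hbb] at this
    linear_combination this - hxx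
  have h3 : 1 - a * x ≠ 0 := by rw [haa]; convert hden5 using 1; ring
  have h4 : 1 - b * x ≠ 0 := by rw [hbb]; convert hden6 using 1; ring
  have hA : (1 - ν * t * qh * x) * (1 + ν⁻¹ * qh * x) = (1 - a * x) * (1 - b * x) := by
    rw [haa, hbb]; ring
  have hphi1 : phiF ν t (qh * x⁻¹) = (q * x ^ 2 - 1) / (q * (x - a) * (x - b)) := by
    rw [phiF, div_eq_div_iff (mul_ne_zero hc1 hc2) (mul_ne_zero (mul_ne_zero hq h1) h2)]
    have e1 : x - a = x * (1 - ν * t * (qh * x⁻¹)) := by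
      rw [haa]; linear_combination (ν * t * qh) * hxx
    have e2 : x - b = x * (1 + ν⁻¹ * (qh * x⁻¹)) := by
      rw [hbb]; linear_combination (-ν⁻¹ * qh) * hxx
    have e3 : q * x ^ 2 - 1 = q * x ^ 2 * (1 - (qh * x⁻¹) ^ 2) := by
      linear_combination (1 + x * x⁻¹) * hxx + (x * x⁻¹) ^ 2 * hqh
    rw [e1, e2, e3]; ring
  have hphi2 : phiF ν t (qh * (x⁻¹)⁻¹) = (q - x ^ 2) / (q * (1 - a * x) * (1 - b * x)) := by
    rw [inv_inv, phiF, div_eq_div_iff (mul_ne_zero hden5 hden6) (mul_ne_zero (mul_ne_zero hq h3) h4)]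
    rw [haa, hbb]
    linear_combination (-x ^ 2 * ((1 - ν * t * qh * x) * (1 + ν⁻¹ * qh * x))) * hqh
  have hD' : 1 - s * x⁻¹ = (x - s) / x := by field_simp
  have hu' : (s - x⁻¹) / (1 - s * x⁻¹) = ((s - x) / (1 - s * x))⁻¹ := by
    rw [hD', inv_div, div_eq_div_iff (div_ne_zero hxs' hx0) hxs]
    field_simp
    ring
  have hx1' : 1 - x⁻¹ ^ 2 ≠ 0 := by
    intro h; apply hden3
    linear_combination (-x ^ 2) * h - (1 + x * x⁻¹) * hxx
  have hu : (s - x) / (1 - s * x) ≠ 0 := div_ne_zero hxs hsx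
  induction L with
  | zero =>
    have e1 : ∀ z, YY n q s z (capW n ν t qh z) 0 K (barC n c, mid n) = 0 := fun z => by
      rw [YY]; apply capW_other n ν t qh z hd.ne' _ hd.ne
      rw [barC_barC]; exact hc.ne'
    have e2 : ∀ z, YY n q s z (capW n ν t qh z) 0 K (c, mid n) = 0 := fun z => by
      rw [YY]; exact capW_other n ν t qh z hc.ne _ hc.ne' hd.ne
    simp [e1, e2]
  | succ L ih =>
    have hcp := capW_mid n ν t qh
    by_cases hK : K (Fin.last L) = fun _ => 0
    · rw [YY_succ_zero n q s x _ (hcp x) hs hsx L K hd.ne' hK,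
        YY_succ_zero n q s x _ (hcp x) hs hsx L K hc.ne hK,
        YY_succ_zero n q s x⁻¹ _ (hcp x⁻¹) hs hden4 L K hc.ne hK]
      have := ih (fun c => K c.castSucc)
      have g1 : gP n s x c = (s - x) / (1 - s * x) * s⁻¹ := by
        simp only [gP, hc, if_true]; field_simp
      have g2 : gP n s x⁻¹ c = ((s - x) / (1 - s * x))⁻¹ * s⁻¹ := by
        rw [← hu']; simp only [gP, hc, if_true]; field_simp
      have g3 : gP n s x (barC n c) = (s - x) / (1 - s * x) * s := by
        simp only [gP, not_lt_of_gt hd, if_false]; ring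
      rw [g1, g2, g3]
      generalize (s - x) / (1 - s * x) = u at *
      simp only [pow_succ _ L]
      have hss : s * s⁻¹ = 1 := mul_inv_cancel₀ hs
      have huu : u * u⁻¹ = 1 := mul_inv_cancel₀ hu
      have hfin := congrArg (fun z => s⁻¹ * z) this
      convert hfin using 1
      · field_simp
      · field_simp
    · rw [YY_succ_ne n q s x _ (hcp x) hs hsx L K hd.ne' hc.ne hcd.symm
          (fun b h1 h2 => capW_other n ν t qh x hd.ne' b h1 (by rwa [barC_barC])) hK,
        YY_succ_ne n q s x _ (hcp x) hs hsx L K hc.ne hd.ne' hcd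
          (fun b h1 h2 => capW_other n ν t qh x hc.ne b h1 h2) hK,
        YY_succ_ne n q s x⁻¹ _ (hcp x⁻¹) hs hden4 L K hc.ne hd.ne' hcd
          (fun b h1 h2 => capW_other n ν t qh x⁻¹ hc.ne b h1 h2) hK]
      have hne : eV n c ≠ eV n (barC n c) := by
        intro h
        have := congrFun h c
        rw [eV_self n hc.ne, eV_ne n hcd] at this
        omega
      have hP : -(x⁻¹ ^ 2 * (1 - q)) / (1 - x⁻¹ ^ 2) = (1 - q) / (1 - x ^ 2) := by
        rw [div_eq_div_iff hx1' hden3]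
        linear_combination ((1 - q) * (1 + x * x⁻¹)) * hxx
      have hP' : x⁻¹ ^ 2 * (1 - q) / (1 - x⁻¹ ^ 2) = -((1 - q) / (1 - x ^ 2)) := by
        rw [← hP]; ring
      have g1 : gP n s x c = (s - x) / (s * (1 - s * x)) := by simp only [gP, hc, if_true]
      have g2 : gP n s x⁻¹ c = (s * x - 1) / (s * (x - s)) := by
        simp only [gP, hc, if_true]; rw [hD']; field_simp
      have g3 : gP n s x (barC n c) = s * (s - x) / (1 - s * x) := by
        simp only [gP, not_lt_of_gt hd, if_false]
      have u1 : gU n s x c = x * (1 - s ^ 2) / (s * (1 - s * x)) := by simp only [gU, hc, if_true]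
      have u2 : gU n s x⁻¹ c = (1 - s ^ 2) / (s * (x - s)) := by
        simp only [gU, hc, if_true]; rw [hD']; field_simp
      have u3 : gU n s x (barC n c) = (1 - s ^ 2) / (1 - s * x) := by
        simp only [gU, not_lt_of_gt hd, if_false]
      have d1 : dU n s x c = (1 - s ^ 2) / (1 - s * x) := by simp only [dU, hc, if_true]
      have d2 : dU n s x⁻¹ c = (1 - s ^ 2) * x / (x - s) := by
        simp only [dU, hc, if_true]; rw [hD']; field_simp
      have d3 : dU n s x (barC n c) = x * (1 - s ^ 2) / (s * (1 - s * x)) := by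
        simp only [dU, not_lt_of_gt hd, if_false]
      have d4 : dU n s x⁻¹ (barC n c) = (1 - s ^ 2) / (s * (x - s)) := by
        simp only [dU, not_lt_of_gt hd, if_false]; rw [hD']; field_simp
      have t1 : dT n q s x c = (1 - s * x * q) / (1 - s * x) := by simp only [dT, hc, if_true]
      have t2 : dT n q s x⁻¹ c = (x - s * q) / (x - s) := by
        simp only [dT, hc, if_true]; rw [hD']; field_simp
      have t3 : dT n q s x (barC n c) = (q⁻¹ - s * x) / (1 - s * x) := by
        simp only [dT, not_lt_of_gt hd, if_false]
      by_cases h0 : ∀ c k, K (Fin.castSucc c) k = 0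
      · simp only [h0, implies_true, if_true]
        by_cases hKc : K (Fin.last L) = eV n c
        · simp only [hKc, hne, if_true, if_false, add_zero, zero_add]
          rw [GG_dc n q s x _ hc hd, GG_cc n q s x _ hc hs hsx hden3,
            GG_cc n q s x⁻¹ _ hc hs hden4 hx1', capW_dc n _ _ _ _ hc, capW_cc n _ _ _ _ hc,
            capW_cc n _ _ _ _ hc, hphi1, hphi2, hu', hP, hP', hA, hab', g1, g2, g3, u1, u2, d1,
            d2, t1, t2]
          have := alg_c a b q s x (((s - x) / (1 - s * x)) ^ L) (s ^ L) hq hs hx0 hsx hxs' hden3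
            hden2 h1 h2 h3 h4 (pow_ne_zero _ hu) (pow_ne_zero _ hs)
          rw [hab] at this
          simp only [pow_succ _ L, inv_pow] at this ⊢
          linear_combination this
        · by_cases hKd : K (Fin.last L) = eV n (barC n c)
          · simp only [hKd, hne.symm, if_true, if_false, add_zero, zero_add]
            rw [GG_cd n q s x _ hc hd, GG_dd n q s x _ hd hs hq hsx hden3,
              GG_cd n q s x⁻¹ _ hc hd, capW_dd n _ _ _ _ hc, capW_cd n _ _ _ _ hc,
              capW_cd n _ _ _ _ hc, hphi1, hphi2, hu', hA, hab', g1, g2, g3, u3, d3, d4, t3]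
            have := alg_d a b q s x (((s - x) / (1 - s * x)) ^ L) (s ^ L) hq hs hx0 hsx hxs' hden3
              hden2 h1 h2 h3 h4 (pow_ne_zero _ hu) (pow_ne_zero _ hs)
            rw [hab] at this
            simp only [pow_succ _ L, inv_pow] at this ⊢
            linear_combination this
          · simp [hKc, hKd]
      · simp [h0]

/-! ### The length function -/

section length
variable (n : ℕ)

lemma barC_inj {a b : Col n} (h : barC n a = barC n b) : a = b := by
  rw [← barC_barC n a, h, barC_barC]

lemma swap_bar (a b k : Col n) :
    barC n (Equiv.swap a b k) = Equiv.swap (barC n a) (barC n b) (barC n k) := by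
  have := (Equiv.swap_apply_apply (⟨barC n, barC n, barC_barC n, barC_barC n⟩ : Equiv.Perm (Col n)) a b)
  have h2 := congrArg (fun e : Equiv.Perm (Col n) => e (barC n k)) this
  simp only [Equiv.Perm.mul_apply] at h2
  rw [show (⟨barC n, barC n, barC_barC n, barC_barC n⟩ : Equiv.Perm (Col n))⁻¹ (barC n k)
    = barC n (barC n k) from rfl, barC_barC] at h2
  exact h2.symm

lemma barC_lt {c : Col n} : mid n < barC n c ↔ c < mid n := by
  simp only [Fin.lt_def, barC, mid]; omega

lemma lastCol_lt (hn : 0 < n) : lastCol n < mid n := by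
  simp only [Fin.lt_def, lastCol, mid]; omega

lemma snB_bar (k : Col n) : snB n (barC n k) = barC n (snB n k) := by
  rw [snB, swap_bar, barC_barC, Equiv.swap_comm]

lemma posC_lt (i : Fin n) : posC n i < mid n := i.isLt

lemma swap_disj (i i' : Fin n) : Equiv.Perm.Disjoint (Equiv.swap (posC n i) (posC n i'))
      (Equiv.swap (barC n (posC n i)) (barC n (posC n i'))) := by
  intro z
  by_cases hz : z < mid n
  · right
    apply Equiv.swap_apply_of_ne_of_ne <;> rintro rfl <;>
      simp only [Fin.lt_def, barC, posC, mid] at hz <;> omega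
  · left
    apply Equiv.swap_apply_of_ne_of_ne <;> rintro rfl <;>
      simp only [Fin.lt_def, posC, mid] at hz <;> omega

lemma siB_bar (i i' : Fin n) (k : Col n) : siB n i i' (barC n k) = barC n (siB n i i' k) := by
  simp only [siB, Equiv.trans_apply, swap_bar, barC_barC]
  have := congrArg (fun e : Equiv.Perm (Col n) => e (barC n k)) (swap_disj n i i').commute.eq
  simp only [Equiv.Perm.mul_apply] at this
  exact this.symm

lemma siB_lo (i i' : Fin n) {k : Col n} (hk : k < mid n) :
    siB n i i' k = Equiv.swap (posC n i) (posC n i') k ∧ siB n i i' k < mid n := by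
  have h1 : Equiv.swap (posC n i) (posC n i') k < mid n := by
    rw [Equiv.swap_apply_def]
    split_ifs
    · exact posC_lt n i'
    · exact posC_lt n i
    · exact hk
  have h2 : siB n i i' k = Equiv.swap (posC n i) (posC n i') k := by
    rw [siB, Equiv.trans_apply]
    apply Equiv.swap_apply_of_ne_of_ne
    · exact (h1.trans (barC_gt n (posC_lt n i))).ne
    · exact (h1.trans (barC_gt n (posC_lt n i'))).ne
  exact ⟨h2, h2 ▸ h1⟩

lemma gens_bar {g : Equiv.Perm (Col n)} (hg : g ∈ gensB n) (k : Col n) :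
    g (barC n k) = barC n (g k) := by
  rcases hg with ⟨i, i', _, rfl⟩ | rfl
  · exact siB_bar n i i' k
  · exact snB_bar n k

lemma word_bar (w : List (Equiv.Perm (Col n))) (hw : ∀ g ∈ w, g ∈ gensB n) (k : Col n) :
    w.prod (barC n k) = barC n (w.prod k) := by
  induction w with
  | nil => simp
  | cons g w ih =>
    simp only [List.prod_cons, Equiv.Perm.mul_apply]
    rw [ih (fun g hg => hw g (List.mem_cons_of_mem _ hg)), gens_bar n (hw g (by simp))]

lemma siB_sign (i i' : Fin n) (k : Col n) : mid n < siB n i i' k ↔ mid n < k := by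
  rcases lt_or_ge k (mid n) with h | h
  · exact iff_of_false (not_lt_of_gt (siB_lo n i i' h).2) (not_lt_of_gt h)
  · have h0 : siB n i i' k = Equiv.swap (barC n (posC n i)) (barC n (posC n i')) k := by
      rw [siB, Equiv.trans_apply, Equiv.swap_apply_of_ne_of_ne (a := posC n i)]
      · exact ((posC_lt n i).trans_le h).ne'
      · exact ((posC_lt n i').trans_le h).ne'
    have h1 := barC_gt n (posC_lt n i)
    have h2 := barC_gt n (posC_lt n i')
    rw [h0, Equiv.swap_apply_def]
    split_ifs with e1 e2
    · exact iff_of_true h2 (e1 ▸ h1)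
    · exact iff_of_true h1 (e2 ▸ h2)
    · exact Iff.rfl

lemma exchange (hn : 0 < n) (w : List (Equiv.Perm (Col n))) (hw : ∀ g ∈ w, g ∈ gensB n)
    (h : mid n < w.prod (lastCol n)) :
    ∃ w' : List (Equiv.Perm (Col n)), w'.length + 1 = w.length ∧ (∀ g ∈ w', g ∈ gensB n) ∧
      w'.prod * snB n = w.prod := by
  induction w with
  | nil =>
    simp at h
    exact absurd h (not_lt_of_gt (lastCol_lt n hn))
  | cons g w ih =>
    have hw' : ∀ g ∈ w, g ∈ gensB n := fun g hg => hw g (List.mem_cons_of_mem _ hg)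
    by_cases hp : mid n < w.prod (lastCol n)
    · obtain ⟨w', h1, h2, h3⟩ := ih hw' hp
      refine ⟨g :: w', by simp [h1], ?_, by rw [List.prod_cons, List.prod_cons, mul_assoc, h3]⟩
      intro g' hg'
      rcases List.mem_cons.1 hg' with rfl | hg'
      · exact hw _ (by simp)
      · exact h2 _ hg'
    · rw [List.prod_cons, Equiv.Perm.mul_apply] at h
      rcases hw g (by simp) with ⟨i, i', _, rfl⟩ | rfl
      · exact absurd ((siB_sign n i i' _).1 h) hp
      · have hl : w.prod (lastCol n) = lastCol n := by
          by_contra hne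
          by_cases hb : w.prod (lastCol n) = barC n (lastCol n)
          · rw [hb] at hp
            exact hp ((barC_lt n).2 (lastCol_lt n hn))
          · rw [snB, Equiv.swap_apply_of_ne_of_ne hne hb] at h
            exact hp h
        refine ⟨w, by simp, hw', ?_⟩
        rw [List.prod_cons, snB, Equiv.mul_swap_eq_swap_mul, word_bar n w hw', hl]

lemma generated (σ : Equiv.Perm (Col n)) (hσ : ∀ k, σ (barC n k) = barC n (σ k)) :
    ∃ w : List (Equiv.Perm (Col n)), (∀ g ∈ w, g ∈ gensB n) ∧ w.prod = σ := by
  induction hm : (toLex fun j : Fin n => σ (posC n j)) using WellFoundedLT.induction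
    generalizing σ with
  | ind m ih =>
  subst hm
  have step : ∀ g ∈ gensB n, g * g = 1 →
      (toLex fun j : Fin n => (σ * g) (posC n j)) < (toLex fun j : Fin n => σ (posC n j)) →
      ∃ w : List (Equiv.Perm (Col n)), (∀ g ∈ w, g ∈ gensB n) ∧ w.prod = σ := by
    intro g hg hgg hlt
    obtain ⟨w, h1, h2⟩ := ih _ hlt (σ * g) (fun k => by
      rw [Equiv.Perm.mul_apply, gens_bar n hg, hσ, Equiv.Perm.mul_apply]) rfl
    refine ⟨w ++ [g], ?_, by simp [h2, mul_assoc, hgg]⟩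
    intro g' hg'
    rcases List.mem_append.1 hg' with hg' | hg'
    · exact h1 _ hg'
    · rw [List.mem_singleton] at hg'; exact hg' ▸ hg
  have hmid : σ (mid n) = mid n := by
    have h := hσ (mid n)
    have h2 : barC n (mid n) = mid n := by ext; simp only [barC, mid]; omega
    rw [h2] at h
    have h3 := congrArg Fin.val h
    ext; simp only [barC, mid] at h3 ⊢; omega
  by_cases hdes : ∃ i i' : Fin n, (i' : ℕ) = (i : ℕ) + 1 ∧ σ (posC n i') < σ (posC n i)
  · obtain ⟨i, i', hii, hlt⟩ := hdes
    have hval : ∀ j : Fin n, siB n i i' (posC n j) =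
        if j = i then posC n i' else if j = i' then posC n i else posC n j := by
      intro j
      rw [(siB_lo n i i' (posC_lt n j)).1, Equiv.swap_apply_def]
      have hinj : ∀ a b : Fin n, posC n a = posC n b ↔ a = b := by
        intro a b; simp [posC, Fin.ext_iff]
      simp only [hinj]
    apply step (siB n i i') (Or.inl ⟨i, i', hii, rfl⟩)
    · have hc := (swap_disj n i i').commute.eq
      have h1 : siB n i i' = Equiv.swap (barC n (posC n i)) (barC n (posC n i')) *
        Equiv.swap (posC n i) (posC n i') := rfl
      rw [h1]
      calc _ = Equiv.swap (barC n (posC n i)) (barC n (posC n i')) *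
            (Equiv.swap (posC n i) (posC n i') *
              Equiv.swap (barC n (posC n i)) (barC n (posC n i'))) *
            Equiv.swap (posC n i) (posC n i') := by simp only [mul_assoc]
        _ = (Equiv.swap (barC n (posC n i)) (barC n (posC n i')) *
              Equiv.swap (barC n (posC n i)) (barC n (posC n i'))) *
            (Equiv.swap (posC n i) (posC n i') * Equiv.swap (posC n i) (posC n i')) := by
              rw [hc]; simp only [mul_assoc]
        _ = 1 := by rw [Equiv.swap_mul_self, Equiv.swap_mul_self, one_mul]
    · refine ⟨i, ?_, ?_⟩
      · intro j hj
        have h1 : j ≠ i := hj.ne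
        have h2 : j ≠ i' := by
          rintro rfl
          have : (j : ℕ) < i := hj
          omega
        simp [hval, h1, h2]
      · simpa [hval] using hlt
  · by_cases hneg : ∃ j : Fin n, (j : ℕ) = n - 1 ∧ mid n < σ (posC n j)
    · obtain ⟨j, hj, hlt⟩ := hneg
      have hjl : posC n j = lastCol n := by ext; simp [posC, lastCol, hj]
      apply step (snB n) (Or.inr rfl)
      · exact Equiv.swap_mul_self _ _
      · refine ⟨j, ?_, ?_⟩
        · intro k hk
          have hk' : (k : ℕ) < j := hk
          have hkk := k.isLt
          have : snB n (posC n k) = posC n k := by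
            rw [snB]
            apply Equiv.swap_apply_of_ne_of_ne <;> intro h <;>
              have h := congrArg Fin.val h <;> simp only [posC, lastCol, barC] at h <;> omega
          simp [this]
        · have : snB n (posC n j) = barC n (posC n j) := by
            rw [hjl, snB, Equiv.swap_apply_left]
          simp only [Pi.toLex_apply, Equiv.Perm.mul_apply, this, hσ]
          simp only [Fin.lt_def, barC, mid] at hlt ⊢
          omega
    · push Not at hdes hneg
      have hmono : ∀ i : Fin n, (i : ℕ) ≤ (σ (posC n i) : ℕ) := by
        rintro ⟨i, hi⟩
        induction i with
        | zero => simp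
        | succ i ihi =>
          have h1 := ihi (by omega)
          have h2 := hdes ⟨i, by omega⟩ ⟨i+1, hi⟩ rfl
          have h3 : σ (posC n ⟨i, by omega⟩) ≠ σ (posC n ⟨i+1, hi⟩) := by
            intro h
            have := congrArg Fin.val (σ.injective h)
            simp [posC] at this
          have h4 := lt_of_le_of_ne h2 h3
          simp only [Fin.lt_def] at h4
          simp only at h1 ⊢
          omega
      have hup : ∀ d : ℕ, ∀ i : Fin n, (i : ℕ) + d = n - 1 → (σ (posC n i) : ℕ) ≤ i := by
        intro d
        induction d with
        | zero =>
          intro i hi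
          have h1 := hneg i (by omega)
          have hin := i.isLt
          have h2 : σ (posC n i) ≠ mid n := by
            rw [← hmid]
            intro h
            have := congrArg Fin.val (σ.injective h)
            simp [posC, mid] at this
            omega
          have h3 := lt_of_le_of_ne h1 h2
          simp only [Fin.lt_def, mid] at h3
          omega
        | succ d ihd =>
          intro i hi
          have h1 := ihd ⟨i+1, by omega⟩ (by simp; omega)
          have h2 := hdes i ⟨i+1, by omega⟩ rfl
          have h3 : σ (posC n i) ≠ σ (posC n ⟨i+1, by omega⟩) := by
            intro h
            have := congrArg Fin.val (σ.injective h)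
            simp [posC] at this
          have h4 := lt_of_le_of_ne h2 h3
          simp only [Fin.lt_def] at h4
          simp only at h1
          omega
      have hfix : ∀ i : Fin n, σ (posC n i) = posC n i := by
        intro i
        have h1 := hmono i
        have h2 := hup (n - 1 - i) i (by have := i.isLt; omega)
        ext
        simp only [posC] at *
        omega
      refine ⟨[], by simp, ?_⟩
      rw [List.prod_nil]
      symm
      ext1 k
      rw [Equiv.Perm.one_apply]
      rcases lt_trichotomy k (mid n) with h | h | h
      · exact hfix ⟨k, h⟩
      · rw [h, hmid]
      · have hk := k.isLt
        have hk2 : n < (k : ℕ) := h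
        have : k = barC n (posC n ⟨2 * n - k, by omega⟩) := by
          ext; simp only [barC, posC]; omega
        rw [this, hσ, hfix]

lemma lenB_snB (hn : 0 < n) (σ : Equiv.Perm (Col n)) (hσ : ∀ k, σ (barC n k) = barC n (σ k))
    (hpos : σ (lastCol n) < mid n) : lenB n ((snB n).trans σ) = lenB n σ + 1 := by
  have hmul : (snB n).trans σ = σ * snB n := rfl
  rw [hmul]
  obtain ⟨w0, hw0, hp0⟩ := generated n σ hσ
  have hmem1 := Nat.sInf_mem (s := {m : ℕ | ∃ w : List (Equiv.Perm (Col n)),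
    w.length = m ∧ (∀ g ∈ w, g ∈ gensB n) ∧ w.prod = σ}) ⟨_, w0, rfl, hw0, hp0⟩
  obtain ⟨w1, hl1, hw1, hp1⟩ := hmem1
  have hin : lenB n σ + 1 ∈ {m : ℕ | ∃ w : List (Equiv.Perm (Col n)),
      w.length = m ∧ (∀ g ∈ w, g ∈ gensB n) ∧ w.prod = σ * snB n} := by
    refine ⟨w1 ++ [snB n], ?_, ?_, by simp [hp1]⟩
    · rw [List.length_append, hl1]; rfl
    · intro g hg
      rcases List.mem_append.1 hg with hg | hg
      · exact hw1 _ hg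
      · rw [List.mem_singleton] at hg; exact Or.inr hg
  apply le_antisymm
  · exact Nat.sInf_le hin
  · obtain ⟨w2, hl2, hw2, hp2⟩ := Nat.sInf_mem ⟨_, hin⟩
    have hneg : mid n < w2.prod (lastCol n) := by
      rw [hp2, Equiv.Perm.mul_apply, snB, Equiv.swap_apply_left, hσ]
      exact (barC_lt n).2 hpos
    obtain ⟨w3, hl3, hw3, hp3⟩ := exchange n hn w2 hw2 hneg
    have : w3.prod = σ := by
      rw [hp2] at hp3
      exact mul_right_cancel hp3
    have hle : lenB n σ ≤ w3.length := Nat.sInf_le ⟨w3, rfl, hw3, this⟩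
    have : lenB n (σ * snB n) = w2.length := hl2.symm
    omega

end length

/-! ### Splitting off the two bottom rows -/

section split

/-- The data of a state above the two bottom rows (plus the bottom boundary level). -/
abbrev Up (m L : ℕ) := ((Fin (2*m) → Fin (L+1) → Col (m+1)) × (Fin (2*m+1) → Fin L → Vec (m+1)))
  × (Fin L → Vec (m+1))

/-- The data of a state in the two bottom rows: (Γ, Δ) horizontal colors, and the vertical
edges between the two rows. -/
abbrev Lw (m L : ℕ) := (Fin (L+1) → Col (m+1) × Col (m+1)) × (Fin L → Vec (m+1))

/-- Gluing of the two parts of a state. -/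
def glue (m L : ℕ) : Up m L × Lw m L ≃ St (m+1) L where
  toFun p :=
    (fun z => (Fin.snoc (n := 2*m+1) (α := fun _ => Fin (L+1) → Col (m+1))
        (Fin.snoc (n := 2*m) (α := fun _ => Fin (L+1) → Col (m+1)) p.1.1.1 (fun i => (p.2.1 i).2))
        (fun i => (p.2.1 i).1) : Fin (2*m+1+1) → Fin (L+1) → Col (m+1)) z.1 z.2,
     fun z => (Fin.snoc (n := 2*m+2) (α := fun _ => Fin L → Vec (m+1))
        (Fin.snoc (n := 2*m+1) (α := fun _ => Fin L → Vec (m+1)) p.1.1.2 p.2.2)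
        p.1.2 : Fin (2*m+2+1) → Fin L → Vec (m+1)) z.1 z.2)
  invFun st :=
    (((fun r i => st.1 (Fin.castSucc (n := 2*m+1) (Fin.castSucc r), i),
       fun r c => st.2 (Fin.castSucc (n := 2*m+2) (Fin.castSucc r), c)),
       fun c => st.2 (Fin.last (2*m+2), c)),
     (fun i => (st.1 (Fin.last (2*m+1), i), st.1 (Fin.castSucc (n := 2*m+1) (Fin.last (2*m)), i)),
       fun c => st.2 (Fin.castSucc (n := 2*m+2) (Fin.last (2*m+1)), c)))
  left_inv p := by
    simp [Fin.snoc_last, Fin.snoc_castSucc]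
  right_inv st := by
    refine Prod.ext ?_ ?_
    · funext z
      obtain ⟨r, i⟩ := z
      refine Fin.lastCases (n := 2*m+1) ?_ (fun r => ?_) r
      · simp
      · refine Fin.lastCases (n := 2*m) ?_ (fun r => ?_) r <;> simp
    · funext z
      obtain ⟨r, i⟩ := z
      refine Fin.lastCases (n := 2*m+2) ?_ (fun r => ?_) r
      · simp
      · refine Fin.lastCases (n := 2*m+1) ?_ (fun r => ?_) r <;> simp

variable (m L : ℕ) (q s ν t qh : ℂ)

lemma glue_h1 (u : Up m L) (l : Lw m L) (i : Fin (L+1)) :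
    (glue m L (u, l)).1 (Fin.last (2*m+1), i) = (l.1 i).1 := by
  simp [glue]

lemma glue_h2 (u : Up m L) (l : Lw m L) (i : Fin (L+1)) :
    (glue m L (u, l)).1 (Fin.castSucc (n := 2*m+1) (Fin.last (2*m)), i) = (l.1 i).2 := by
  simp [glue]

lemma glue_h3 (u : Up m L) (l : Lw m L) (r : Fin (2*m)) (i : Fin (L+1)) :
    (glue m L (u, l)).1 (Fin.castSucc (n := 2*m+1) (Fin.castSucc r), i) = u.1.1 r i := by
  simp [glue]

lemma glue_v1 (u : Up m L) (l : Lw m L) (i : Fin L) :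
    (glue m L (u, l)).2 (Fin.last (2*m+2), i) = u.2 i := by
  simp [glue]

lemma glue_v2 (u : Up m L) (l : Lw m L) (i : Fin L) :
    (glue m L (u, l)).2 (Fin.castSucc (n := 2*m+2) (Fin.last (2*m+1)), i) = l.2 i := by
  simp [glue]

lemma glue_v3 (u : Up m L) (l : Lw m L) (r : Fin (2*m+1)) (i : Fin L) :
    (glue m L (u, l)).2 (Fin.castSucc (n := 2*m+2) (Fin.castSucc r), i) = u.1.2 r i := by
  simp [glue]

/-- Weight of the upper part. -/
noncomputable def Wup (y : Fin m → ℂ) (u : Up m L) : ℂ :=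
  (∏ r : Fin (2*m), ∏ c : Fin L,
    if r.val % 2 = 0 then
      MW (m+1) q s (y ⟨r.val / 2, by have := r.isLt; omega⟩)
        (u.1.2 r.succ c) (u.1.1 r c.castSucc) (u.1.2 r.castSucc c) (u.1.1 r c.succ)
    else
      LW (m+1) q s (y ⟨r.val / 2, by have := r.isLt; omega⟩)
        (u.1.2 r.succ c) (u.1.1 r c.succ) (u.1.2 r.castSucc c) (u.1.1 r c.castSucc))
  * ∏ i : Fin m,
      capW (m+1) ν t qh (y i)
        (u.1.1 ⟨2 * i.val + 1, by have := i.isLt; omega⟩ 0)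
        (u.1.1 ⟨2 * i.val, by have := i.isLt; omega⟩ 0)

/-- Weight of the two bottom rows. -/
noncomputable def Wlo (z : ℂ) (u : Up m L) (l : Lw m L) : ℂ :=
  (∏ c : Fin L, MW (m+1) q s z (l.2 c) (l.1 c.castSucc).2 (u.1.2 (Fin.last (2*m)) c) (l.1 c.succ).2)
  * (∏ c : Fin L, LW (m+1) q s z (u.2 c) (l.1 c.succ).1 (l.2 c) (l.1 c.castSucc).1)
  * capW (m+1) ν t qh z (l.1 0).1 (l.1 0).2

lemma stWt_glue (x : Fin (m+1) → ℂ) (u : Up m L) (l : Lw m L) :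
    stWt (m+1) L q s ν t qh x (glue m L (u, l)) =
      Wup m L q s ν t qh (fun i => x i.castSucc) u * Wlo m L q s ν t qh (x (Fin.last m)) u l := by
  have hrow := Fin.prod_univ_castSucc (n := 2*m+1) (M := ℂ) (fun r => ∏ c : Fin L,
    if r.val % 2 = 0 then
      MW (m+1) q s (x ⟨r.val / 2, by have := r.isLt; omega⟩)
        ((glue m L (u, l)).2 (r.succ, c)) ((glue m L (u, l)).1 (r, c.castSucc))
        ((glue m L (u, l)).2 (r.castSucc, c)) ((glue m L (u, l)).1 (r, c.succ))
    else
      LW (m+1) q s (x ⟨r.val / 2, by have := r.isLt; omega⟩)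
        ((glue m L (u, l)).2 (r.succ, c)) ((glue m L (u, l)).1 (r, c.succ))
        ((glue m L (u, l)).2 (r.castSucc, c)) ((glue m L (u, l)).1 (r, c.castSucc)))
  rw [Fin.prod_univ_castSucc (n := 2*m)] at hrow
  rw [stWt]
  refine (congrArg₂ (· * ·) hrow (Fin.prod_univ_castSucc (n := m) _)).trans ?_
  rw [Wup, Wlo]
  have e1 : ∀ r : Fin (2*m), (Fin.castSucc (n := 2*m+1) (Fin.castSucc r)).succ
      = Fin.castSucc (n := 2*m+2) (Fin.castSucc r.succ) := fun r => rfl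
  have e2 : (Fin.castSucc (n := 2*m+1) (Fin.last (2*m))).succ
      = Fin.castSucc (n := 2*m+2) (Fin.last (2*m+1)) := rfl
  have e3 : (Fin.last (2*m+1)).succ = Fin.last (2*m+2) := rfl
  have f1 : ∀ i : Fin m, (⟨2 * (Fin.castSucc i).val + 1, by have := i.isLt; simp; omega⟩ : Fin (2*(m+1)))
      = Fin.castSucc (n := 2*m+1) (Fin.castSucc ⟨2 * i.val + 1, by have := i.isLt; omega⟩) := fun i => rfl
  have f2 : ∀ i : Fin m, (⟨2 * (Fin.castSucc i).val, by have := i.isLt; simp⟩ : Fin (2*(m+1)))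
      = Fin.castSucc (n := 2*m+1) (Fin.castSucc ⟨2 * i.val, by have := i.isLt; omega⟩) := fun i => rfl
  have f3 : (⟨2 * (Fin.last m).val + 1, by simp; omega⟩ : Fin (2*(m+1))) = Fin.last (2*m+1) := rfl
  have f4 : (⟨2 * (Fin.last m).val, by simp⟩ : Fin (2*(m+1)))
    = Fin.castSucc (n := 2*m+1) (Fin.last (2*m)) := rfl
  have p1 : (Fin.castSucc (n := 2*m+1) (Fin.last (2*m))).val % 2 = 0 := by simp
  have p2 : ¬ (Fin.last (2*m+1)).val % 2 = 0 := by simp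
  have x1 : (⟨(Fin.castSucc (n := 2*m+1) (Fin.last (2*m))).val / 2, by simp⟩ : Fin (m+1))
    = Fin.last m := by ext; simp
  have x2 : (⟨(Fin.last (2*m+1)).val / 2, by simp; omega⟩ : Fin (m+1))
    = Fin.last m := by ext; simp; omega
  simp only [p1, p2, if_true, if_false, e1, e2, e3, f1, f2, f3, f4, x1, x2]
  simp only [glue_h1, glue_h2, glue_h3, glue_v1, glue_v2, glue_v3]
  have v1 : ∀ (r : Fin (2*m)), (Fin.castSucc (n := 2*m+1) (Fin.castSucc r)).val = r.val := fun r => rfl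
  simp only [v1]
  have x3 : ∀ r : Fin (2*m), (⟨r.val / 2, by have := r.isLt; omega⟩ : Fin (m+1))
    = Fin.castSucc ⟨r.val / 2, by have := r.isLt; omega⟩ := fun r => rfl
  simp only [x3]
  ring

/-- Boundary conditions on the upper part. -/
def BCup (σ : Equiv.Perm (Col (m+1))) (μ : Fin (m+1) → ℤ) (u : Up m L) : Prop :=
  (∀ r : Fin (2*m), u.1.1 r (Fin.last L) =
      if r.val % 2 = 0 then mid (m+1)
      else σ (posC (m+1) (Fin.castSucc ⟨r.val / 2, by have := r.isLt; omega⟩))) ∧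
  (∀ c : Fin L, u.1.2 0 c = topV (m+1) L μ c) ∧
  (∀ c : Fin L, u.2 c = fun _ => 0)

lemma BC_glue (σ : Equiv.Perm (Col (m+1))) (μ : Fin (m+1) → ℤ) (u : Up m L) (l : Lw m L) :
    BC (m+1) L σ μ (glue m L (u, l)) ↔
      BCup m L σ μ u ∧ l.1 (Fin.last L) = (σ (posC (m+1) (Fin.last m)), mid (m+1)) := by
  have h0 := fun (P : Fin (2*m+1+1) → Prop) => Fin.forall_fin_succ' (P := P)
  have h1 := fun (P : Fin (2*m+1) → Prop) => Fin.forall_fin_succ' (P := P)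
  rw [BC, BCup]
  have hr := (h0 (fun r => (glue m L (u, l)).1 (r, Fin.last L) =
      if r.val % 2 = 0 then mid (m+1)
      else σ (posC (m+1) ⟨r.val / 2, by have := r.isLt; omega⟩))).trans
      (and_congr_left fun _ => h1 _)
  have p2 : ¬ (Fin.last (2*m+1)).val % 2 = 0 := by simp
  have p1 : (Fin.castSucc (n := 2*m+1) (Fin.last (2*m))).val % 2 = 0 := by simp
  have x2 : (⟨(Fin.last (2*m+1)).val / 2, by simp; omega⟩ : Fin (m+1))
    = Fin.last m := by ext; simp; omega
  have e4 : (0 : Fin (2*(m+1)+1)) = Fin.castSucc (n := 2*m+2) (Fin.castSucc (0 : Fin (2*m+1))) := rfl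
  have e5 : (Fin.last (2*(m+1))) = Fin.last (2*m+2) := rfl
  rw [glue_h1, glue_h2, if_neg p2, if_pos p1, x2] at hr
  simp only [glue_h3] at hr
  refine (and_congr hr Iff.rfl).trans ?_
  simp only [e4, e5, glue_v3, glue_v1]
  rw [Prod.ext_iff]
  constructor
  · rintro ⟨⟨⟨a, b⟩, c⟩, d⟩
    exact ⟨⟨a, d⟩, c, b⟩
  · rintro ⟨⟨a, d⟩, c, b⟩
    exact ⟨⟨⟨a, b⟩, c⟩, d⟩

/-- Transfer-matrix form of the two-row partition function. -/
lemma YY_eq_sum (n : ℕ) (x : ℂ) (cp : Col n → Col n → ℂ) (L : ℕ) (K : Fin L → Vec n)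
    (p : Col n × Col n) :
    (∑ h : Fin (L+1) → Col n × Col n, if h (Fin.last L) = p then
      (∏ c : Fin L, wt2 n q s x (K c) (h c.succ) (h c.castSucc)) * cp (h 0).1 (h 0).2 else 0)
    = YY n q s x cp L K p := by
  induction L generalizing p with
  | zero =>
    rw [YY, Fintype.sum_equiv (Equiv.funUnique (Fin 1) (Col n × Col n)) _
      (fun z => if z = p then cp z.1 z.2 else 0)]
    · simp
    · intro h
      simp [Equiv.funUnique]
  | succ L ih =>
    rw [YY, ← Fintype.sum_equiv (Fin.snocEquiv (fun _ : Fin (L+2) => Col n × Col n))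
      (fun z => if z.1 = p then wt2 n q s x (K (Fin.last L)) z.1 (z.2 (Fin.last L)) *
        ((∏ c : Fin L, wt2 n q s x (K c.castSucc) (z.2 c.succ) (z.2 c.castSucc)) *
          cp (z.2 0).1 (z.2 0).2) else 0)]
    · rw [Fintype.sum_prod_type, Finset.sum_eq_single p]
      · simp only [if_true]
        simp_rw [← ih]
        simp_rw [Finset.mul_sum]
        rw [Finset.sum_comm]
        apply Finset.sum_congr rfl
        intro h _
        simp
      · intro p' _ hp'
        simp [hp']
      · simp
    · rintro ⟨z, h⟩
      simp only [Fin.snocEquiv, Equiv.coe_fn_mk]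
      have h0 : (Fin.snoc h z : ∀ _ : Fin (L+2), Col n × Col n) 0 = h 0 :=
        Fin.snoc_castSucc (α := fun _ => Col n × Col n) z h 0
      rw [Fin.prod_univ_castSucc]
      simp only [Fin.succ_last, Fin.snoc_last, Fin.snoc_castSucc, h0]
      simp only [Fin.succ_castSucc, Fin.snoc_castSucc]
      split_ifs <;> ring

lemma Z_eq (z : ℂ) (u : Up m L) (hu : ∀ c, u.2 c = fun _ => 0) (p : Col (m+1) × Col (m+1)) :
    (∑ᶠ l : Lw m L, if l.1 (Fin.last L) = p then Wlo m L q s ν t qh z u l else 0)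
    = YY (m+1) q s z (capW (m+1) ν t qh z) L (u.1.2 (Fin.last (2*m))) p := by
  set vs : (Fin (L+1) → Col (m+1) × Col (m+1)) → Fin L → Vec (m+1) :=
    fun h c k => eV (m+1) (h c.succ).1 k - eV (m+1) (h c.castSucc).1 k with hvs
  have hz : ∀ h v, v ≠ vs h → Wlo m L q s ν t qh z u (h, v) = 0 := by
    intro h v hv
    by_contra hne
    apply hv
    rw [Wlo] at hne
    have h1 := right_ne_zero_of_mul (left_ne_zero_of_mul hne)
    rw [Finset.prod_ne_zero_iff] at h1
    funext c k
    have h2 := LW_cons _ _ _ _ (h1 c (Finset.mem_univ c)) k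
    simp only [hu, zero_add] at h2
    simp only [hvs]
    omega
  rw [finsum_curry]
  · rw [finsum_eq_sum_of_fintype, ← YY_eq_sum]
    apply Finset.sum_congr rfl
    intro h _
    rw [finsum_eq_single _ (vs h)]
    · simp only [Wlo, hu, hvs, ← Finset.prod_mul_distrib]
      congr 2
      apply Finset.prod_congr rfl
      intro c _
      rw [wt2, mul_comm]
    · intro v hv
      simp [hz h v hv]
  · apply (Set.finite_range (fun h => (h, vs h))).subset
    rintro ⟨h, v⟩ hl
    refine ⟨h, ?_⟩
    by_contra hne
    have hv : v ≠ vs h := by rintro rfl; exact hne rfl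
    simp [hz h v hv] at hl

/-- The state sum has finite support. -/
lemma finite_support (n : ℕ) (x : Fin n → ℂ) (σ : Equiv.Perm (Col n)) (μ : Fin n → ℤ) :
    {st : St n L | BC n L σ μ st ∧ stWt n L q s ν t qh x st ≠ 0}.Finite := by
  apply (Set.finite_univ.prod (Set.finite_Icc
    (fun _ _ => 0 : Fin (2*n+1) × Fin L → Vec n) (fun _ _ => 2*n))).subset
  rintro ⟨h, v⟩ ⟨⟨_, _, hb⟩, hne⟩
  refine ⟨trivial, fun z k => Nat.zero_le _, ?_⟩
  rintro ⟨r, c⟩ k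
  have key : ∀ r : Fin (2*n+1), v (r, c) k + r ≤ 2*n := by
    intro r
    induction r using Fin.reverseInduction with
    | last => simp only at hb; simp [hb c]
    | cast r ih =>
      rw [stWt] at hne
      have h1 := left_ne_zero_of_mul hne
      rw [Finset.prod_ne_zero_iff] at h1
      have h2 := h1 r (Finset.mem_univ _)
      rw [Finset.prod_ne_zero_iff] at h2
      have h3 := h2 c (Finset.mem_univ _)
      have hle : ∀ j k, eV n j k ≤ 1 := by
        intro j k; rw [eV]; split_ifs <;> simp
      simp only [Fin.val_succ] at ih
      simp only [Fin.val_castSucc]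
      split_ifs at h3
      · have h4 := MW_cons _ _ _ _ h3 k
        have := hle (h (r, c.castSucc)) k
        simp only at h4
        omega
      · have h4 := LW_cons _ _ _ _ h3 k
        have := hle (h (r, c.succ)) k
        simp only at h4
        omega
  have := key r
  simp only
  omega

open Classical in
/-- The contribution of an upper part to the partition function. -/
noncomputable def Gup (y : Fin m → ℂ) (σ : Equiv.Perm (Col (m+1))) (μ : Fin (m+1) → ℤ)
    (u : Up m L) : ℂ := if BCup m L σ μ u then Wup m L q s ν t qh y u else 0

lemma pf_eq (x : Fin (m+1) → ℂ) (σ : Equiv.Perm (Col (m+1))) (μ : Fin (m+1) → ℤ) :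
    (Function.support fun u : Up m L => Gup m L q s ν t qh (fun i => x i.castSucc) σ μ u *
      YY (m+1) q s (x (Fin.last m)) (capW (m+1) ν t qh (x (Fin.last m))) L
        (u.1.2 (Fin.last (2*m))) (σ (posC (m+1) (Fin.last m)), mid (m+1))).Finite ∧
    pf (m+1) L q s ν t qh x σ μ =
      ∑ᶠ u : Up m L, Gup m L q s ν t qh (fun i => x i.castSucc) σ μ u *
        YY (m+1) q s (x (Fin.last m)) (capW (m+1) ν t qh (x (Fin.last m))) L
          (u.1.2 (Fin.last (2*m))) (σ (posC (m+1) (Fin.last m)), mid (m+1)) := by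
  classical
  set F : Up m L × Lw m L → ℂ := fun p =>
    if BC (m+1) L σ μ (glue m L p) then stWt (m+1) L q s ν t qh x (glue m L p) else 0 with hF
  have hfin : (Function.support F).Finite := by
    apply ((finite_support L q s ν t qh (m+1) x σ μ).preimage
      ((glue m L).injective.injOn)).subset
    intro p hp
    simp only [hF, Function.mem_support, ne_eq, ite_eq_right_iff, not_forall] at hp
    obtain ⟨h1, h2⟩ := hp
    exact ⟨h1, h2⟩
  have hinner : ∀ u : Up m L, Gup m L q s ν t qh (fun i => x i.castSucc) σ μ u *
      YY (m+1) q s (x (Fin.last m)) (capW (m+1) ν t qh (x (Fin.last m))) L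
        (u.1.2 (Fin.last (2*m))) (σ (posC (m+1) (Fin.last m)), mid (m+1))
      = ∑ᶠ l, F (u, l) := by
    intro u
    simp only [hF, BC_glue, stWt_glue, Gup]
    by_cases hu : BCup m L σ μ u
    · rw [if_pos hu, ← Z_eq m L q s ν t qh _ u hu.2.2, mul_finsum]
      · congr 1
        funext l
        simp only [hu, true_and, mul_ite, mul_zero]
    · simp [hu]
  simp only [hinner]
  constructor
  · apply (hfin.image Prod.fst).subset
    intro u hu
    obtain ⟨l, hl⟩ : ∃ l, F (u, l) ≠ 0 := by
      by_contra hcon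
      push Not at hcon
      exact hu (by simp [hcon])
    exact ⟨(u, l), hl, rfl⟩
  · rw [pf, ← finsum_curry F hfin, finsum_mem_def, ← finsum_comp_equiv (glue m L)]
    congr 1

end split

/-! ### Assembling the recursion -/

lemma lin_finsum {α : Type*} (f g h : α → ℂ) (a b c d : ℂ)
    (hg : (Function.support g).Finite) (hh : (Function.support h).Finite)
    (H : ∀ u, a * f u = b * (c * g u) + d * h u) :
    a * ∑ᶠ u, f u = b * (c * ∑ᶠ u, g u) + d * ∑ᶠ u, h u := by
  rw [mul_finsum, mul_finsum, mul_finsum, mul_finsum, ← finsum_add_distrib]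
  · exact finsum_congr H
  · exact hg.subset (fun u hu => by
      simp only [Function.mem_support] at hu ⊢
      exact right_ne_zero_of_mul (right_ne_zero_of_mul hu))
  · exact hh.subset (fun u hu => by
      simp only [Function.mem_support] at hu ⊢
      exact right_ne_zero_of_mul hu)

lemma snB_last (m : ℕ) : snB (m+1) (posC (m+1) (Fin.last m))
    = barC (m+1) (posC (m+1) (Fin.last m)) := by
  have : posC (m+1) (Fin.last m) = lastCol (m+1) := by
    ext; simp [posC, lastCol]
  rw [this, snB, Equiv.swap_apply_left]

lemma snB_cast (m : ℕ) (i : Fin m) : snB (m+1) (posC (m+1) i.castSucc)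
    = posC (m+1) i.castSucc := by
  have := i.isLt
  rw [snB, Equiv.swap_apply_of_ne_of_ne]
  · intro h
    simp only [Fin.ext_iff, posC, lastCol, Fin.val_castSucc] at h
    omega
  · intro h
    simp only [Fin.ext_iff, posC, lastCol, barC, Fin.val_castSucc] at h
    omega

lemma pf_rec (m L : ℕ) (q s ν t qh : ℂ) (x : Fin (m+1) → ℂ) (z : ℂ)
    (hz : x (Fin.last m) = z)
    (hq : q ≠ 0) (hs : s ≠ 0) (hν : ν ≠ 0) (hqh : qh ^ 2 * q = 1)
    (hx0 : z ≠ 0) (hsx : 1 - s * z ≠ 0) (hxs : s - z ≠ 0)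
    (hc1 : 1 - ν * t * (qh * z⁻¹) ≠ 0) (hc2 : 1 + ν⁻¹ * (qh * z⁻¹) ≠ 0)
    (hden2 : z ^ 2 - q ≠ 0) (hden3 : 1 - z ^ 2 ≠ 0) (hden4 : 1 - s * z⁻¹ ≠ 0)
    (hden5 : 1 - ν * t * (qh * z) ≠ 0) (hden6 : 1 + ν⁻¹ * (qh * z) ≠ 0)
    (σ : Equiv.Perm (Col (m+1))) (hσ : ∀ k, σ (barC (m+1) k) = barC (m+1) (σ k))
    (μ : Fin (m+1) → ℤ) (hσn : σ (posC (m+1) (Fin.last m)) < mid (m+1)) :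
    t * ((s ^ L) ^ 2)⁻¹ * (((s - z) / (1 - s * z)) ^ L)⁻¹ *
        pf (m+1) L q s ν t qh x ((snB (m+1)).trans σ) μ
      = (1 - ν * t * qh * z) * (1 + ν⁻¹ * qh * z) / (1 - z ^ 2) *
        (((s - z) / (1 - s * z)) ^ L * ((1 - q * z ^ 2) / (z ^ 2 - q)) *
            pf (m+1) L q s ν t qh (Function.update x (Fin.last m) z⁻¹) σ μ
          - (((s - z) / (1 - s * z)) ^ L)⁻¹ * pf (m+1) L q s ν t qh x σ μ)
        + t / q * ((((s - z) / (1 - s * z)) ^ L)⁻¹ * pf (m+1) L q s ν t qh x σ μ) := by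
  obtain ⟨-, h1⟩ := pf_eq m L q s ν t qh x ((snB (m+1)).trans σ) μ
  obtain ⟨f2, h2⟩ := pf_eq m L q s ν t qh (Function.update x (Fin.last m) z⁻¹) σ μ
  obtain ⟨f3, h3⟩ := pf_eq m L q s ν t qh x σ μ
  have hG : ∀ u, Gup m L q s ν t qh (fun i => x i.castSucc) ((snB (m+1)).trans σ) μ u
      = Gup m L q s ν t qh (fun i => x i.castSucc) σ μ u := by
    intro u
    have hB : BCup m L ((snB (m+1)).trans σ) μ u ↔ BCup m L σ μ u := by
      simp only [BCup, Equiv.trans_apply, snB_cast]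
    rw [Gup, Gup]
    by_cases h : BCup m L σ μ u
    · rw [if_pos h, if_pos (hB.2 h)]
    · rw [if_neg h, if_neg (fun h' => h (hB.1 h'))]
  have hu : (fun i : Fin m => Function.update x (Fin.last m) z⁻¹ i.castSucc)
      = fun i => x i.castSucc := by
    funext i
    rw [Function.update_of_ne (Fin.castSucc_lt_last i).ne]
  simp only [hu, Function.update_self] at f2 h2
  simp only [hG, Equiv.trans_apply, snB_last, hσ] at h1
  rw [hz] at f3 h1 h3
  rw [h1, h2, h3]
  have key := lin_finsum
    (fun u => Gup m L q s ν t qh (fun i => x i.castSucc) σ μ u *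
      YY (m+1) q s z (capW (m+1) ν t qh z) L (u.1.2 (Fin.last (2*m)))
        (barC (m+1) (σ (posC (m+1) (Fin.last m))), mid (m+1))) _ _
    (t * ((s ^ L) ^ 2)⁻¹ * (((s - z) / (1 - s * z)) ^ L)⁻¹)
    ((1 - ν * t * qh * z) * (1 + ν⁻¹ * qh * z) / (1 - z ^ 2))
    (((s - z) / (1 - s * z)) ^ L * ((1 - q * z ^ 2) / (z ^ 2 - q)))
    ((t / q - (1 - ν * t * qh * z) * (1 + ν⁻¹ * qh * z) / (1 - z ^ 2)) *
      (((s - z) / (1 - s * z)) ^ L)⁻¹) f2 f3  (by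
      intro u
      have := local_rec (m+1) q s ν t qh z hq hs hν hqh hx0 hsx hxs hc1 hc2 hden2 hden3 hden4
        hden5 hden6 hσn L (u.1.2 (Fin.last (2*m)))
      linear_combination (Gup m L q s ν t qh (fun i => x i.castSucc) σ μ u) * this)
  rw [key]
  ring

/-- Hecke-type recursion for the normalized partition
function at `s_n`, assuming `σ(n) ∈ [n]`: `F_μ^{σ s_n} = T_n F_μ^σ` with
`a = νtq^{-1/2}`, `b = -ν⁻¹q^{-1/2}`.  Here `nn` is the 0-indexed last
position (the paper's `n`), `qh` is the fixed branch of `q^{-1/2}`, and the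
square root used for the argument `s_n·x` is the reciprocal of the one used
for `x`, i.e. `r` is replaced by `Function.update r nn (r nn)⁻¹`. -/
theorem normalized_recursion_sn (n L : ℕ) (hn : 0 < n) (hL : 0 < L)
    (q s ν t qh : ℂ) (x r : Fin n → ℂ)
    (hq : q ≠ 0) (hs : s ≠ 0) (hν : ν ≠ 0) (ht : t ≠ 0) (hqh : qh ^ 2 * q = 1)
    (hr : ∀ j, (r j) ^ 2 = ((x j) ^ 2 - q) / (1 - q * (x j) ^ 2))
    (hx0 : ∀ j, x j ≠ 0) (hsx : ∀ j, 1 - s * x j ≠ 0) (hxs : ∀ j, s - x j ≠ 0)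
    (hqx : ∀ j, 1 - q * (x j) ^ 2 ≠ 0)
    (hc1 : ∀ j, 1 - ν * t * (qh * (x j)⁻¹) ≠ 0)
    (hc2 : ∀ j, 1 + ν⁻¹ * (qh * (x j)⁻¹) ≠ 0)
    (σ : Equiv.Perm (Col n)) (hσ : ∀ k, σ (barC n k) = barC n (σ k))
    (μ : Fin n → ℤ) (hμ : ∀ j, 1 ≤ |μ j| ∧ |μ j| ≤ (L : ℤ))
    (nn : Fin n) (hnn : (nn : ℕ) = n - 1)
    (hσn : σ (posC n nn) < mid n)
    (hden2 : (x nn) ^ 2 - q ≠ 0) (hden3 : 1 - (x nn) ^ 2 ≠ 0)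
    (hden4 : 1 - s * (x nn)⁻¹ ≠ 0)
    (hden5 : 1 - ν * t * (qh * x nn) ≠ 0) (hden6 : 1 + ν⁻¹ * (qh * x nn) ≠ 0) :
    Fnorm n L q s ν t qh x r ((snB n).trans σ) μ
      = ((1 - ν * t * qh * x nn) * (1 + ν⁻¹ * qh * x nn) / (1 - (x nn) ^ 2))
          * (Fnorm n L q s ν t qh (Function.update x nn (x nn)⁻¹)
                (Function.update r nn (r nn)⁻¹) σ μ
            - Fnorm n L q s ν t qh x r σ μ)
        + (t / q) * Fnorm n L q s ν t qh x r σ μ := by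
  obtain ⟨m, rfl⟩ : ∃ m, n = m + 1 := ⟨n - 1, by omega⟩
  obtain rfl : nn = Fin.last m := by ext; simp [hnn]
  have hz0 := hx0 (Fin.last m)
  have hzs := hsx (Fin.last m)
  have hsz := hxs (Fin.last m)
  have hqz := hqx (Fin.last m)
  have hrz := hr (Fin.last m)
  have hlast : posC (m+1) (Fin.last m) = lastCol (m+1) := by
    ext; simp [posC, lastCol]
  have key := pf_rec m L q s ν t qh x _ rfl hq hs hν hqh hz0 hzs hsz (hc1 _) (hc2 _)
    hden2 hden3 hden4 hden5 hden6 σ hσ μ hσn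
  have hlen := lenB_snB (m+1) hn σ hσ (hlast ▸ hσn)
  have hbar := barC_gt (m+1) hσn
  have hup : ∀ (f : Fin (m+1) → ℂ) (w : ℂ) (i : Fin m),
      Function.update f (Fin.last m) w i.castSucc = f i.castSucc := by
    intro f w i
    rw [Function.update_of_ne (Fin.castSucc_lt_last i).ne]
  have hr0 : r (Fin.last m) ≠ 0 := by
    intro h
    rw [h, eq_comm] at hrz
    simp [hden2, hqz] at hrz
  have hrinv : (r (Fin.last m))⁻¹ = r (Fin.last m) *
      ((1 - q * x (Fin.last m) ^ 2) / (x (Fin.last m) ^ 2 - q)) := by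
    apply inv_eq_of_mul_eq_one_right
    rw [← mul_assoc, ← pow_two, hrz]
    rw [div_mul_div_comm, mul_comm, div_self (mul_ne_zero hqz hden2)]
  have hfac : ((1 - s * x (Fin.last m)) / (s - x (Fin.last m))) ^ L
      = (((s - x (Fin.last m)) / (1 - s * x (Fin.last m))) ^ L)⁻¹ := by
    rw [← inv_pow, inv_div]
  have hfac' : ((1 - s * (x (Fin.last m))⁻¹) / (s - (x (Fin.last m))⁻¹)) ^ L
      = ((s - x (Fin.last m)) / (1 - s * x (Fin.last m))) ^ L := by
    congr 1
    have h1 : s - (x (Fin.last m))⁻¹ ≠ 0 := by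
      intro h
      apply hzs
      have := mul_inv_cancel₀ hz0
      linear_combination -x (Fin.last m) * h - this
    rw [div_eq_div_iff h1 hzs]
    field_simp
    ring
  simp only [Fnorm, hlen, Fin.sum_univ_castSucc, Fin.prod_univ_castSucc, Equiv.trans_apply,
    snB_last, snB_cast, hσ, hbar, not_lt_of_gt hbar, hσn, not_lt_of_gt hσn, if_true, if_false,
    hup, Function.update_self, Fin.val_last, add_tsub_cancel_right, tsub_self, mul_zero, zero_mul,
    add_zero, hfac, hfac', hrinv]
  have hsL : ∀ N : ℤ, s ^ (-(2 * (L : ℤ) * (N + 1)))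
      = s ^ (-(2 * (L : ℤ) * N)) * ((s ^ L) ^ 2)⁻¹ := by
    intro N
    rw [mul_add, neg_add, zpow_add₀ hs]
    congr 1
    rw [mul_one, zpow_neg, mul_comm, zpow_mul]
    norm_cast
  have htq : q * (t / q) = t := by field_simp
  rw [add_right_comm, pow_succ, pow_succ, hsL]
  generalize q ^ (lenB (m+1) σ + _) = Q
  generalize s ^ (-(2 * (L : ℤ) * _)) = S
  generalize (t / q) ^ (∑ i : Fin m, _) = B
  generalize (∏ i : Fin m, ((1 - s * x i.castSucc) / (s - x i.castSucc)) ^ L) = P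
  generalize (∏ i : Fin m, r i.castSucc) = R
  linear_combination (Q * S * B * P * R * r (Fin.last m)) * key
    + Q * S * ((s ^ L) ^ 2)⁻¹ * B * P * (((s - x (Fin.last m)) / (1 - s * x (Fin.last m))) ^ L)⁻¹
      * R * r (Fin.last m) * pf (m+1) L q s ν t qh x ((snB (m+1)).trans σ) μ * htq
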